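/- arXiv:1504.02035 — 7 statements merged into one kernel-verified Lean document; each statement's English description precedes it below -/
import Mathlib

section
/- For all sufficiently large m and all positive integers n with 4n ≤ (1/10)·log₂ m, there exists an (m, s)-query graph with s = ⌈4 · m^{1 − 1/(4n+1)}⌉ whose girth is greater than 4n. -/
/-- An `(m,s)`-query graph: a graph `G` on three disjoint sets of vertices `A`,
`A₀`, `A₁` (here `Sum.inl`, `Sum.inr ∘ Sum.inl`, `Sum.inr ∘ Sum.inr`, each a copy
of `Fin s`), in which every vertex of `A` has even degree, together with, for each
`x ∈ [m]`, a triple `(i x, i0 x, i1 x) ∈ A × A₀ × A₁` such that `{i x, i0 x}` and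
`{i x, i1 x}` are edges of `G`; both edges are labeled `x`, and no edge receives
more than one label (expressed by the two injectivity conditions). -/
structure QueryGraph (m s : ℕ) where
  G : SimpleGraph (Fin s ⊕ (Fin s ⊕ Fin s))
  i : Fin m → Fin s
  i0 : Fin m → Fin s
  i1 : Fin m → Fin s
  adj0 : ∀ x : Fin m, G.Adj (Sum.inl (i x)) (Sum.inr (Sum.inl (i0 x)))
  adj1 : ∀ x : Fin m, G.Adj (Sum.inl (i x)) (Sum.inr (Sum.inr (i1 x)))
  evenDeg : ∀ v : Fin s, Even (G.neighborSet (Sum.inl v)).ncard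
  label0 : Function.Injective (fun x : Fin m => (i x, i0 x))
  label1 : Function.Injective (fun x : Fin m => (i x, i1 x))

namespace SimpleGraph

theorem Walk.edges_mem_edgeSet_of_sup_edge {V : Type*} {G : SimpleGraph V} {a b x y : V}
    (p : (G ⊔ edge a b).Walk x y) (hp : s(a, b) ∉ p.edges) : ∀ e ∈ p.edges, e ∈ G.edgeSet := by
  intro e he
  have hmem := p.edges_subset_edgeSet he
  induction e with
  | _ u v =>
    simp only [SimpleGraph.mem_edgeSet, sup_adj, edge_adj] at hmem ⊢
    rcases hmem with h | ⟨⟨rfl, rfl⟩ | ⟨rfl, rfl⟩, -⟩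
    · exact h
    · exact absurd he hp
    · rw [Sym2.eq_swap] at he
      exact absurd he hp

/-- Joining two vertices at distance at least `g` keeps the girth above `g`. -/
theorem lt_egirth_sup_edge {V : Type*} {G : SimpleGraph V} {a b : V} {g : ℕ}
    (hG : (g : ℕ∞) < G.egirth) (hab : ∀ p : G.Walk a b, g ≤ p.length) :
    (g : ℕ∞) < (G ⊔ edge a b).egirth := by
  classical
  have ends_at_edge : ∀ c : (G ⊔ edge a b).Walk a a, c.IsCycle → c.snd = b → g < c.length := by
    intro c hc hsnd
    have hcons := hc
    rw [← Walk.cons_tail_eq c hc.not_nil, Walk.cons_isCycle_iff] at hcons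
    have he : s(a, b) ∉ c.tail.edges := by
      rw [show s(a, b) = s(a, c.snd) by rw [hsnd]]
      exact hcons.2
    have htransfer := c.tail.edges_mem_edgeSet_of_sup_edge he
    have hlen := hab ((c.tail.transfer G htransfer).copy hsnd rfl).reverse
    have htail := Walk.length_tail_add_one hc.not_nil
    simp only [Walk.length_reverse, Walk.length_copy, Walk.length_transfer] at hlen
    omega
  have through_edge : ∀ c : (G ⊔ edge a b).Walk a a, c.IsCycle → s(a, b) ∈ c.edges →
      g < c.length := by
    intro c hc he
    have hmem : b ∈ c.toSubgraph.neighborSet a := by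
      rwa [Subgraph.mem_neighborSet, Walk.adj_toSubgraph_iff_mem_edges]
    rw [hc.neighborSet_toSubgraph_endpoint] at hmem
    rcases hmem with h | h
    · exact ends_at_edge c hc h.symm
    · simpa using ends_at_edge c.reverse hc.reverse ((Walk.snd_reverse c).trans h.symm)
  rw [← Order.add_one_le_iff_of_not_isMax (by simp), le_egirth] at hG ⊢
  intro x c hc
  by_cases he : s(a, b) ∈ c.edges
  · have ha : a ∈ c.support := Walk.fst_mem_support_of_mem_edges c he
    have hlen := through_edge (c.rotate a ha) (hc.rotate ha)
      ((c.rotate_edges a ha).perm.mem_iff.mpr he)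
    rw [Walk.length_rotate] at hlen
    exact_mod_cast hlen
  · have htransfer := c.edges_mem_edgeSet_of_sup_edge he
    simpa using hG x _ (hc.transfer htransfer)

/-- A ball of radius less than `k` in a graph with degrees at most `Δ` has fewer than `Δ ^ k`
vertices. -/
theorem ncard_walk_length_lt {V : Type*} [Finite V] {G : SimpleGraph V} {Δ : ℕ} (hΔ : 2 ≤ Δ)
    (hdeg : ∀ v, (G.neighborSet v).ncard ≤ Δ) (k : ℕ) (u : V) :
    {v | ∃ p : G.Walk u v, p.length < k}.ncard < Δ ^ k := by
  induction k generalizing u with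
  | zero => simp
  | succ k ih =>
    let N := (Set.toFinite (G.neighborSet u)).toFinset
    have hsub : {v | ∃ p : G.Walk u v, p.length < k + 1} ⊆
        insert u (⋃ w ∈ N, {v | ∃ p : G.Walk w v, p.length < k}) := by
      rintro v ⟨p, hp⟩
      cases p with
      | nil => exact Set.mem_insert _ _
      | cons h q =>
        refine Set.mem_insert_of_mem _ (Set.mem_iUnion₂.mpr ⟨_, by simpa [N] using h, q, ?_⟩)
        simpa using hp
    have hN : N.card ≤ Δ := by
      rw [← Set.ncard_eq_toFinset_card]
      exact hdeg u
    have hpos : 0 < Δ ^ k := by positivity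
    have hunion : (⋃ w ∈ N, {v | ∃ p : G.Walk w v, p.length < k}).ncard ≤ Δ * (Δ ^ k - 1) := by
      calc _ ≤ ∑ w ∈ N, {v | ∃ p : G.Walk w v, p.length < k}.ncard :=
            Finset.set_ncard_biUnion_le N _
        _ ≤ N.card • (Δ ^ k - 1) := Finset.sum_le_card_nsmul _ _ _ fun w _ => by
            have := ih w
            omega
        _ ≤ Δ * (Δ ^ k - 1) := Nat.mul_le_mul_right _ hN
    have hcard := (Set.ncard_le_ncard hsub).trans (Set.ncard_insert_le _ _)
    obtain ⟨e, he⟩ : ∃ e, Δ ^ k = e + 1 := ⟨Δ ^ k - 1, by omega⟩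
    rw [he, Nat.add_sub_cancel] at hunion
    rw [pow_succ, he]
    nlinarith

theorem ncard_neighborSet_sup_edge_le {V : Type*} [Finite V] (G : SimpleGraph V) (a b v : V) :
    ((G ⊔ edge a b).neighborSet v).ncard ≤ (G.neighborSet v).ncard + 1 := by
  classical
  refine (Set.ncard_le_ncard (t := insert (if v = a then b else a) (G.neighborSet v)) ?_).trans
    (Set.ncard_insert_le _ _)
  intro w hw
  simp only [mem_neighborSet, sup_adj, edge_adj, Set.mem_insert_iff] at hw ⊢
  grind

end SimpleGraph

open SimpleGraph

/-- The union of the paths `b - a - c` over the triples `(a, b, c)` in `T`. -/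
def cherryGraph {α β γ : Type*} (T : Finset (α × β × γ)) : SimpleGraph (α ⊕ (β ⊕ γ)) :=
  .fromRel fun x y => ∃ t ∈ T, x = .inl t.1 ∧ (y = .inr (.inl t.2.1) ∨ y = .inr (.inr t.2.2))

section cherryGraph

variable {α β γ : Type*} {T : Finset (α × β × γ)}

theorem cherryGraph_adj_left {a : α} {b : β} :
    (cherryGraph T).Adj (.inl a) (.inr (.inl b)) ↔ ∃ t ∈ T, t.1 = a ∧ t.2.1 = b := by
  simp [cherryGraph, fromRel_adj]

theorem cherryGraph_adj_right {a : α} {c : γ} :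
    (cherryGraph T).Adj (.inl a) (.inr (.inr c)) ↔ ∃ t ∈ T, t.1 = a ∧ t.2.2 = c := by
  simp [cherryGraph, fromRel_adj]

theorem cherryGraph_not_adj_inl {a a' : α} : ¬ (cherryGraph T).Adj (.inl a) (.inl a') := by
  simp [cherryGraph, fromRel_adj]

theorem cherryGraph_not_adj_inr {z z' : β ⊕ γ} : ¬ (cherryGraph T).Adj (.inr z) (.inr z') := by
  simp [cherryGraph, fromRel_adj]

theorem cherryGraph_empty : cherryGraph (∅ : Finset (α × β × γ)) = ⊥ := by
  ext x y
  simp [cherryGraph, fromRel_adj]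

variable [DecidableEq α] [DecidableEq β] [DecidableEq γ]

theorem cherryGraph_insert (a : α) (b : β) (c : γ) :
    cherryGraph (insert (a, b, c) T) =
      cherryGraph T ⊔ edge (.inl a) (.inr (.inl b)) ⊔ edge (.inl a) (.inr (.inr c)) := by
  ext x y
  simp only [cherryGraph, fromRel_adj, sup_adj, edge_adj, Finset.exists_mem_insert]
  grind

theorem cherryGraph_neighborSet_inl (a : α) :
    (cherryGraph T).neighborSet (.inl a) =
      ↑((T.filter (·.1 = a)).image fun t => (.inr (.inl t.2.1) : α ⊕ (β ⊕ γ))) ∪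
      ↑((T.filter (·.1 = a)).image fun t => (.inr (.inr t.2.2) : α ⊕ (β ⊕ γ))) := by
  ext (x | x | x)
  · simp [cherryGraph_not_adj_inl]
  · simp [cherryGraph_adj_left, and_assoc]
  · simp [cherryGraph_adj_right, and_assoc]

theorem ncard_cherryGraph_neighborSet_le {d : ℕ}
    (ha : ∀ a, (T.filter (·.1 = a)).card ≤ d) (hb : ∀ b, (T.filter (·.2.1 = b)).card ≤ d)
    (hc : ∀ c, (T.filter (·.2.2 = c)).card ≤ d) (v : α ⊕ (β ⊕ γ)) :
    ((cherryGraph T).neighborSet v).ncard ≤ 2 * d := by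
  rcases v with a | b | c
  · rw [cherryGraph_neighborSet_inl]
    refine (Set.ncard_union_le _ _).trans ?_
    rw [Set.ncard_coe_finset, Set.ncard_coe_finset]
    have := ha a
    linarith [Finset.card_image_le (s := T.filter (·.1 = a))
        (f := fun t => (.inr (.inl t.2.1) : α ⊕ (β ⊕ γ))),
      Finset.card_image_le (s := T.filter (·.1 = a))
        (f := fun t => (.inr (.inr t.2.2) : α ⊕ (β ⊕ γ)))]
  · have hset : (cherryGraph T).neighborSet (.inr (.inl b)) =
        ↑((T.filter (·.2.1 = b)).image fun t => (.inl t.1 : α ⊕ (β ⊕ γ))) := by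
      ext (x | x)
      · simp [adj_comm _ (Sum.inr (Sum.inl b)), cherryGraph_adj_left]
      · simp [cherryGraph_not_adj_inr]
    rw [hset, Set.ncard_coe_finset]
    linarith [hb b, Finset.card_image_le (s := T.filter (·.2.1 = b))
      (f := fun t => (.inl t.1 : α ⊕ (β ⊕ γ)))]
  · have hset : (cherryGraph T).neighborSet (.inr (.inr c)) =
        ↑((T.filter (·.2.2 = c)).image fun t => (.inl t.1 : α ⊕ (β ⊕ γ))) := by
      ext (x | x)
      · simp [adj_comm _ (Sum.inr (Sum.inr c)), cherryGraph_adj_right]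
      · simp [cherryGraph_not_adj_inr]
    rw [hset, Set.ncard_coe_finset]
    linarith [hc c, Finset.card_image_le (s := T.filter (·.2.2 = c))
      (f := fun t => (.inl t.1 : α ⊕ (β ⊕ γ)))]

theorem even_ncard_cherryGraph_neighborSet_inl
    (hb : Set.InjOn (fun t : α × β × γ => (t.1, t.2.1)) T)
    (hc : Set.InjOn (fun t : α × β × γ => (t.1, t.2.2)) T) (a : α) :
    Even ((cherryGraph T).neighborSet (.inl a)).ncard := by
  rw [cherryGraph_neighborSet_inl, Set.ncard_union_eq, Set.ncard_coe_finset,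
    Set.ncard_coe_finset, Finset.card_image_of_injOn, Finset.card_image_of_injOn]
  · exact ⟨_, rfl⟩
  · intro t ht t' ht' h
    simp only [Finset.coe_filter, Set.mem_ofPred_eq] at ht ht'
    exact hc ht.1 ht'.1 (Prod.ext (ht.2.trans ht'.2.symm) (by simpa using h))
  · intro t ht t' ht' h
    simp only [Finset.coe_filter, Set.mem_ofPred_eq] at ht ht'
    exact hb ht.1 ht'.1 (Prod.ext (ht.2.trans ht'.2.symm) (by simpa using h))
  · rw [Set.disjoint_left]
    simp

end cherryGraph

theorem Finset.exists_notMem_card_fiber_lt {ι κ : Type*} [Fintype κ] [DecidableEq κ]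
    (T : Finset ι) (f : ι → κ) (S : Finset κ) {d : ℕ}
    (h : S.card * d + T.card < Fintype.card κ * d) :
    ∃ y ∉ S, (T.filter (f · = y)).card < d := by
  by_contra! hcon
  have hsum : Sᶜ.card * d ≤ T.card := by
    calc Sᶜ.card * d = Sᶜ.card • d := rfl
      _ ≤ ∑ y ∈ Sᶜ, (T.filter (f · = y)).card :=
          Finset.card_nsmul_le_sum _ _ _ fun y hy => hcon y (by simpa using hy)
      _ ≤ ∑ y, (T.filter (f · = y)).card :=
          Finset.sum_le_sum_of_subset (Finset.subset_univ _)
      _ = T.card := (Finset.card_eq_sum_card_fiberwise fun _ _ => Finset.mem_coe.mpr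
          (Finset.mem_univ _)).symm
  have hcompl := Finset.card_add_card_compl S
  nlinarith

theorem Finset.card_filter_insert_le_of_lt {ι κ : Type*} [DecidableEq ι] [DecidableEq κ]
    {T : Finset ι} {f : ι → κ} {d : ℕ} (t : ι) (hT : ∀ y, (T.filter (f · = y)).card ≤ d)
    (ht : (T.filter (f · = f t)).card < d) (y : κ) :
    ((insert t T).filter (f · = y)).card ≤ d := by
  rw [Finset.filter_insert]
  split_ifs with h
  · subst h
    exact (Finset.card_insert_le _ _).trans ht
  · exact hT y

/-- Among the copies of a vertex set of size `s`, one of the underfull ones lies far from `u`. -/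
theorem exists_far_card_fiber_lt {V ι : Type*} [Finite V] {G : SimpleGraph V} {Δ g d s : ℕ}
    (hΔ : 2 ≤ Δ) (hdeg : ∀ v, (G.neighborSet v).ncard ≤ Δ) (u : V) {φ : Fin s → V}
    (hφ : φ.Injective) (T : Finset ι) (f : ι → Fin s) (h : Δ ^ g * d + T.card < s * d) :
    ∃ y, (∀ p : G.Walk u (φ y), g ≤ p.length) ∧ (T.filter (f · = y)).card < d := by
  classical
  let S : Finset (Fin s) := Finset.univ.filter fun y => ∃ p : G.Walk u (φ y), p.length < g
  have hS : S.card ≤ Δ ^ g := by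
    have hball := ncard_walk_length_lt hΔ hdeg g u
    have : S.card ≤ {v | ∃ p : G.Walk u v, p.length < g}.ncard := by
      rw [← Set.ncard_coe_finset, ← Set.ncard_image_of_injective _ hφ]
      refine Set.ncard_le_ncard ?_
      rintro _ ⟨y, hy, rfl⟩
      simpa [S] using hy
    omega
  obtain ⟨y, hy, hlt⟩ := T.exists_notMem_card_fiber_lt f S (d := d) (by
    rw [Fintype.card_fin]
    nlinarith [Nat.mul_le_mul_right d hS])
  exact ⟨y, by simpa [S] using hy, hlt⟩

theorem exists_cherryGraph_lt_egirth {s d g m : ℕ} (hd : 1 ≤ d) (hg : 2 ≤ g)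
    (hs : (2 * d + 1) ^ g * d + m ≤ s * d) :
    ∃ T : Finset (Fin s × Fin s × Fin s), T.card = m ∧
      Set.InjOn (fun t => (t.1, t.2.1)) (T : Set (Fin s × Fin s × Fin s)) ∧
      Set.InjOn (fun t => (t.1, t.2.2)) (T : Set (Fin s × Fin s × Fin s)) ∧
      (g : ℕ∞) < (cherryGraph T).egirth := by
  suffices h : ∀ k ≤ m, ∃ T : Finset (Fin s × Fin s × Fin s), T.card = k ∧
      Set.InjOn (fun t => (t.1, t.2.1)) (T : Set (Fin s × Fin s × Fin s)) ∧
      Set.InjOn (fun t => (t.1, t.2.2)) (T : Set (Fin s × Fin s × Fin s)) ∧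
      (∀ a, (T.filter (·.1 = a)).card ≤ d) ∧ (∀ b, (T.filter (·.2.1 = b)).card ≤ d) ∧
      (∀ c, (T.filter (·.2.2 = c)).card ≤ d) ∧ (g : ℕ∞) < (cherryGraph T).egirth by
    obtain ⟨T, h₁, h₂, h₃, -, -, -, h₄⟩ := h m le_rfl
    exact ⟨T, h₁, h₂, h₃, h₄⟩
  intro k
  induction k with
  | zero =>
    intro _
    exact ⟨∅, by simp, by simp, by simp, by simp, by simp, by simp, by
      rw [cherryGraph_empty, egirth_bot]
      exact ENat.natCast_lt_top g⟩
  | succ k ih =>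
    intro hk
    obtain ⟨T, hcard, hinj₀, hinj₁, hA, hB, hC, hgirth⟩ := ih (by omega)
    have hroom : (2 * d + 1) ^ g * d + T.card < s * d := by omega
    have hdeg := ncard_cherryGraph_neighborSet_le hA hB hC
    obtain ⟨a, -, ha⟩ := T.exists_notMem_card_fiber_lt (·.1) ∅ (d := d) (by
      rw [Fintype.card_fin, Finset.card_empty]
      omega)
    obtain ⟨b, hab, hb⟩ := exists_far_card_fiber_lt (by omega)
      (fun v => (hdeg v).trans (Nat.le_succ _)) (.inl a)
      (φ := fun y => (.inr (.inl y) : Fin s ⊕ (Fin s ⊕ Fin s)))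
      (Sum.inr_injective.comp Sum.inl_injective) T (·.2.1) hroom
    obtain ⟨c, hac, hc⟩ := exists_far_card_fiber_lt
      (G := cherryGraph T ⊔ edge (.inl a) (.inr (.inl b))) (by omega)
      (fun v => (ncard_neighborSet_sup_edge_le _ _ _ v).trans (Nat.succ_le_succ (hdeg v))) (.inl a)
      (φ := fun y => (.inr (.inr y) : Fin s ⊕ (Fin s ⊕ Fin s)))
      (Sum.inr_injective.comp Sum.inr_injective) T (·.2.2) hroom
    have hnb : ∀ t ∈ T, (t.1, t.2.1) ≠ (a, b) := by
      intro t ht h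
      have hadj : (cherryGraph T).Adj (.inl a) (.inr (.inl b)) :=
        cherryGraph_adj_left.mpr ⟨t, ht, congrArg Prod.fst h, congrArg Prod.snd h⟩
      have := hab hadj.toWalk
      simp at this
      omega
    have hnc : ∀ t ∈ T, (t.1, t.2.2) ≠ (a, c) := by
      intro t ht h
      have hadj : (cherryGraph T ⊔ edge (.inl a) (.inr (.inl b))).Adj (.inl a) (.inr (.inr c)) :=
        .inl (cherryGraph_adj_right.mpr ⟨t, ht, congrArg Prod.fst h, congrArg Prod.snd h⟩)
      have := hac hadj.toWalk
      simp at this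
      omega
    have hnew : (a, b, c) ∉ T := fun h => hnb _ h rfl
    refine ⟨insert (a, b, c) T, by rw [Finset.card_insert_of_notMem hnew, hcard], ?_, ?_,
      Finset.card_filter_insert_le_of_lt _ hA ha, Finset.card_filter_insert_le_of_lt _ hB hb,
      Finset.card_filter_insert_le_of_lt _ hC hc, ?_⟩
    · rw [Finset.coe_insert, Set.injOn_insert hnew]
      refine ⟨hinj₀, ?_⟩
      rintro ⟨t, ht, h⟩
      exact hnb t ht h
    · rw [Finset.coe_insert, Set.injOn_insert hnew]
      refine ⟨hinj₁, ?_⟩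
      rintro ⟨t, ht, h⟩
      exact hnc t ht h
    · rw [cherryGraph_insert]
      exact lt_egirth_sup_edge (lt_egirth_sup_edge hgirth hab) hac

theorem QueryGraph.exists_lt_egirth {s d g m : ℕ} (hd : 1 ≤ d) (hg : 2 ≤ g)
    (hs : (2 * d + 1) ^ g * d + m ≤ s * d) :
    ∃ Q : QueryGraph m s, (g : ℕ∞) < Q.G.egirth := by
  obtain ⟨T, hcard, hinj₀, hinj₁, hgirth⟩ := exists_cherryGraph_lt_egirth hd hg hs
  let e : Fin m ≃ T := (T.equivFinOfCardEq hcard).symm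
  exact ⟨{
    G := cherryGraph T
    i := fun x => (e x).1.1
    i0 := fun x => (e x).1.2.1
    i1 := fun x => (e x).1.2.2
    adj0 := fun x => cherryGraph_adj_left.mpr ⟨_, (e x).2, rfl, rfl⟩
    adj1 := fun x => cherryGraph_adj_right.mpr ⟨_, (e x).2, rfl, rfl⟩
    evenDeg := even_ncard_cherryGraph_neighborSet_inl hinj₀ hinj₁
    label0 := fun x y h => e.injective (Subtype.ext (hinj₀ (e x).2 (e y).2 h))
    label1 := fun x y h => e.injective (Subtype.ext (hinj₁ (e x).2 (e y).2 h)) }, hgirth⟩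

/-- For all sufficiently large `m` and all positive integers `n` with
`4n ≤ (1/10)·log₂ m`, there exists an `(m,s)`-query graph with
`s = ⌈4·m^(1-1/(4n+1))⌉` whose girth is greater than `4n`. -/
theorem high_girth_query_graph_exists :
    ∃ M : ℕ, ∀ m : ℕ, M ≤ m → ∀ n : ℕ, 1 ≤ n →
      (4 * (n : ℝ) ≤ (1 / 10) * Real.logb 2 (m : ℝ)) →
      ∃ Q : QueryGraph m (⌈4 * (m : ℝ) ^ ((1 : ℝ) - 1 / (4 * (n : ℝ) + 1))⌉₊),
        (4 * n : ℕ∞) < Q.G.egirth := by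
  refine ⟨1, fun m hm n hn hlog => ?_⟩
  have hm0 : (0 : ℝ) < m := by exact_mod_cast hm
  set t : ℝ := (m : ℝ) ^ (1 / (4 * (n : ℝ) + 1)) with ht
  have ht0 : 0 < t := Real.rpow_pos_of_pos hm0 _
  have htm : t ^ (4 * n + 1) = m := by
    rw [ht, ← Real.rpow_natCast, ← Real.rpow_mul hm0.le]
    push_cast
    rw [one_div_mul_cancel (by positivity), Real.rpow_one]
  have htg : (m : ℝ) ^ ((1 : ℝ) - 1 / (4 * (n : ℝ) + 1)) = t ^ (4 * n) := by
    rw [Real.rpow_sub hm0, Real.rpow_one, ← ht, div_eq_iff ht0.ne', ← pow_succ, htm]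
  have hm2 : (2 : ℝ) ^ (40 * n) ≤ m := by
    rw [← Real.rpow_natCast, ← Real.le_logb_iff_rpow_le (by norm_num) hm0]
    push_cast
    linarith
  have ht9 : 9 ≤ t := by
    refine le_of_pow_le_pow_left₀ (n := 4 * n + 1) (by omega) ht0.le ?_
    calc (9 : ℝ) ^ (4 * n + 1) ≤ (2 ^ 4) ^ (4 * n + 1) := by gcongr; norm_num
      _ = 2 ^ (4 * (4 * n + 1)) := by rw [← pow_mul]
      _ ≤ 2 ^ (40 * n) := pow_le_pow_right₀ (by norm_num) (by omega)
      _ ≤ t ^ (4 * n + 1) := hm2.trans_eq htm.symm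
  set d := ⌊(t - 1) / 2⌋₊ with hd
  have hd_le : (d : ℝ) ≤ (t - 1) / 2 := Nat.floor_le (by linarith)
  have hd_lt : (t - 1) / 2 < d + 1 := Nat.lt_floor_add_one _
  have hd1 : 1 ≤ d := Nat.le_floor (by push_cast; linarith)
  rw [htg]
  have hroom : (2 * d + 1) ^ (4 * n) * d + m ≤ ⌈4 * t ^ (4 * n)⌉₊ * d := by
    have hpow : (2 * (d : ℝ) + 1) ^ (4 * n) ≤ t ^ (4 * n) := by gcongr; linarith
    have hceil := Nat.le_ceil (4 * t ^ (4 * n))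
    have hreal : (2 * (d : ℝ) + 1) ^ (4 * n) * d + m ≤ ⌈4 * t ^ (4 * n)⌉₊ * d := by
      calc (2 * (d : ℝ) + 1) ^ (4 * n) * d + m ≤ t ^ (4 * n) * d + t ^ (4 * n) * t := by
            rw [← pow_succ, htm]
            gcongr
        _ = t ^ (4 * n) * (d + t) := by ring
        _ ≤ t ^ (4 * n) * (4 * d) := by
            gcongr
            linarith
        _ = 4 * t ^ (4 * n) * d := by ring
        _ ≤ ⌈4 * t ^ (4 * n)⌉₊ * d := by gcongr
    exact_mod_cast hreal
  obtain ⟨Q, hQ⟩ := QueryGraph.exists_lt_egirth hd1 (by omega) hroom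
  exact ⟨Q, by exact_mod_cast hQ⟩
end

section
/- Let G_Φ be a pseudo-graph associated with a systematic two-probe scheme Φ over memory [s]. Let C be a cycle in G_Φ starting and ending at a vertex v, and let b ∈ {0,1}. Then there are disjoint subsets S_0, S_1 ⊆ lab(C), each of size at most |C|+1, such that for every set S ⊆ [m] with S_1 ⊆ S ⊆ [m]∖S_0 and every memory assignment σ ∈ {0,1}^s under which Φ answers all membership queries 'Is x in S?' correctly, the memory location corresponding to v is assigned the value b under σ. Moreover, if b = 0 then |S_1| = |C|−1, and if b = 1 then |S_1| = |C|+1. -/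
/-- A systematic two-probe scheme over memory `[s]` for universe `[m]`: on query
`x`, the bit at location `fst x` is read; if it is `0` the answer is the bit at
location `snd0 x`, and if it is `1` the answer is the bit at location `snd1 x`
(`1` = Yes). -/
structure SysTwoProbe (m s : ℕ) where
  fst : Fin m → Fin s
  snd0 : Fin m → Fin s
  snd1 : Fin m → Fin s

/-- The answer of a systematic two-probe scheme on memory `σ` for query `x`. -/
def SysTwoProbe.answer {m s : ℕ} (Φ : SysTwoProbe m s) (σ : Fin s → Bool) (x : Fin m) : Bool :=
  if σ (Φ.fst x) then σ (Φ.snd1 x) else σ (Φ.snd0 x)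

/-- `Φ.Correct σ S`: under memory assignment `σ`, `Φ` answers every membership
query "Is `x` in `S`?" correctly. -/
def SysTwoProbe.Correct {m s : ℕ} (Φ : SysTwoProbe m s) (σ : Fin s → Bool)
    (S : Finset (Fin m)) : Prop :=
  ∀ x : Fin m, (Φ.answer σ x = true ↔ x ∈ S)

/-- A pseudo-graph `G_Φ` associated with a systematic two-probe scheme `Φ`.
Its vertex set is `A₀ ⊕ A₁` (two copies of `[s]`, `Sum.inl` being `A₀` and
`Sum.inr` being `A₁`). It is described by a set `pairs` of ordered pairs
`(x, x')` of distinct elements of `[m]` with the same first probe (color);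
the pairs are mutually disjoint, and for each color at most one element of that
color is left unpaired. The ordered pair `(x, x')` yields the pseudo-edge joining
`A₀[snd0 x]` and `A₁[snd1 x']`, with label `{(A₀[snd0 x], x), (A₁[snd1 x'], x')}`. -/
structure PseudoGraph (m s : ℕ) (Φ : SysTwoProbe m s) where
  pairs : Finset (Fin m × Fin m)
  ne : ∀ p ∈ pairs, p.1 ≠ p.2
  sameColor : ∀ p ∈ pairs, Φ.fst p.1 = Φ.fst p.2
  disjointPairs : ∀ p ∈ pairs, ∀ q ∈ pairs, p ≠ q →
    p.1 ≠ q.1 ∧ p.1 ≠ q.2 ∧ p.2 ≠ q.1 ∧ p.2 ≠ q.2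
  nearPerfect : ∀ c : Fin s,
    (Finset.univ.filter
      (fun x : Fin m => Φ.fst x = c ∧ ∀ p ∈ pairs, x ≠ p.1 ∧ x ≠ p.2)).card ≤ 1

/-- The memory location in `[s]` corresponding to a vertex `A₀[j]` or `A₁[j]`
of the pseudo-graph. -/
def PGloc {s : ℕ} : Fin s ⊕ Fin s → Fin s := Sum.elim id id

/-- A cycle in the pseudo-graph `G_Φ`: distinct vertices `v 0, …, v (len-1)` and
distinct pseudo-edges `e 0, …, e (len-1)` (given as ordered pairs from `pairs`),
where the pseudo-edge `e i`, joining `A₀[snd0 (e i).1]` and `A₁[snd1 (e i).2]`,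
connects `v i` with `v (i+1)` (indices mod `len`). -/
structure PGCycle {m s : ℕ} {Φ : SysTwoProbe m s} (PG : PseudoGraph m s Φ) where
  len : ℕ
  pos : 0 < len
  v : Fin len → Fin s ⊕ Fin s
  e : Fin len → Fin m × Fin m
  mem : ∀ i, e i ∈ PG.pairs
  conn : ∀ i : Fin len,
    (v i = Sum.inl (Φ.snd0 (e i).1) ∧
      v ⟨(i.val + 1) % len, Nat.mod_lt _ pos⟩ = Sum.inr (Φ.snd1 (e i).2)) ∨
    (v i = Sum.inr (Φ.snd1 (e i).2) ∧
      v ⟨(i.val + 1) % len, Nat.mod_lt _ pos⟩ = Sum.inl (Φ.snd0 (e i).1))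
  vInj : Function.Injective v
  eInj : Function.Injective e

/-- `lab C`: the set of elements of the universe appearing in the label of some
edge of the cycle `C`. -/
def PGCycle.lab {m s : ℕ} {Φ : SysTwoProbe m s} {PG : PseudoGraph m s Φ}
    (C : PGCycle PG) : Set (Fin m) :=
  {x | ∃ i, (C.e i).1 = x ∨ (C.e i).2 = x}

/-- The starting vertex of the cycle. -/
def PGCycle.start {m s : ℕ} {Φ : SysTwoProbe m s} {PG : PseudoGraph m s Φ}
    (C : PGCycle PG) : Fin s ⊕ Fin s :=
  C.v ⟨0, C.pos⟩

/-- A correct memory assignment, read along an edge of the pseudo-graph: one of the two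
endpoints stores the membership bit of the element it is labelled with. -/
theorem SysTwoProbe.Correct.eq_or_eq {m s : ℕ} {Φ : SysTwoProbe m s} {σ : Fin s → Bool}
    {S : Finset (Fin m)} (h : Φ.Correct σ S) {x y : Fin m} (hxy : Φ.fst x = Φ.fst y) :
    σ (Φ.snd0 x) = decide (x ∈ S) ∨ σ (Φ.snd1 y) = decide (y ∈ S) := by
  have hx := h x
  have hy := h y
  unfold SysTwoProbe.answer at hx hy
  rw [hxy] at hx
  cases hc : σ (Φ.fst y) <;> simp only [hc, if_true, if_false, Bool.false_eq_true] at hx hy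
  · exact .inl (Bool.eq_iff_iff.2 (hx.trans decide_eq_true_iff.symm))
  · exact .inr (Bool.eq_iff_iff.2 (hy.trans decide_eq_true_iff.symm))

namespace PGCycle

variable {m s : ℕ} {Φ : SysTwoProbe m s} {PG : PseudoGraph m s Φ} (C : PGCycle PG)

/-- The element labelling the `i`-th edge of the cycle at its initial vertex `C.v i`. -/
def tail (i : Fin C.len) : Fin m := if (C.v i).isLeft then (C.e i).1 else (C.e i).2

/-- The element labelling the `i`-th edge of the cycle at its terminal vertex `C.v (i + 1)`. -/
def head (i : Fin C.len) : Fin m := if (C.v i).isLeft then (C.e i).2 else (C.e i).1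

theorem tail_mem_lab (i : Fin C.len) : C.tail i ∈ C.lab := by
  unfold tail lab
  split
  · exact ⟨i, .inl rfl⟩
  · exact ⟨i, .inr rfl⟩

theorem head_mem_lab (i : Fin C.len) : C.head i ∈ C.lab := by
  unfold head lab
  split
  · exact ⟨i, .inr rfl⟩
  · exact ⟨i, .inl rfl⟩

theorem tail_injective : Function.Injective C.tail := by
  intro i j hij
  by_contra hne
  obtain ⟨h₁, h₂, h₃, h₄⟩ := PG.disjointPairs _ (C.mem i) _ (C.mem j) (C.eInj.ne hne)
  unfold tail at hij
  split at hij <;> split at hij <;> contradiction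

theorem head_injective : Function.Injective C.head := by
  intro i j hij
  by_contra hne
  obtain ⟨h₁, h₂, h₃, h₄⟩ := PG.disjointPairs _ (C.mem i) _ (C.mem j) (C.eInj.ne hne)
  unfold head at hij
  split at hij <;> split at hij <;> contradiction

theorem tail_ne_head (i j : Fin C.len) : C.tail i ≠ C.head j := by
  intro hij
  by_cases hne : i = j
  · subst hne
    have h := PG.ne _ (C.mem i)
    unfold tail head at hij
    split at hij
    · exact h hij
    · exact h hij.symm
  · obtain ⟨h₁, h₂, h₃, h₄⟩ := PG.disjointPairs _ (C.mem i) _ (C.mem j) (C.eInj.ne hne)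
    unfold tail head at hij
    split at hij <;> split at hij <;> contradiction

theorem eq_tail_or_eq_head {σ : Fin s → Bool} {S : Finset (Fin m)} (h : Φ.Correct σ S)
    (i : Fin C.len) :
    σ (PGloc (C.v i)) = decide (C.tail i ∈ S) ∨
      σ (PGloc (C.v ⟨(i.val + 1) % C.len, Nat.mod_lt _ C.pos⟩)) = decide (C.head i ∈ S) := by
  have key := h.eq_or_eq (PG.sameColor _ (C.mem i))
  rcases C.conn i with ⟨h₁, h₂⟩ | ⟨h₁, h₂⟩
  · rw [h₂]
    simpa [tail, head, h₁, PGloc] using key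
  · rw [h₂]
    simpa [tail, head, h₁, PGloc] using key.symm

/-- If all heads except the last one are in `S` and all tails except the first one are not,
then the two exceptional elements force the bit at the starting vertex. -/
theorem start_eq_of_correct {σ : Fin s → Bool} {S : Finset (Fin m)} (h : Φ.Correct σ S)
    (b : Bool) (hhead : ∀ i : Fin C.len, i.val + 1 ≠ C.len → C.head i ∈ S)
    (htail : ∀ i : Fin C.len, i.val ≠ 0 → C.tail i ∉ S)
    (hfirst : ∀ i : Fin C.len, i.val = 0 → decide (C.tail i ∈ S) = b)
    (hlast : ∀ i : Fin C.len, i.val + 1 = C.len → decide (C.head i ∈ S) = b) :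
    σ (PGloc C.start) = b := by
  by_contra hb
  have walk : ∀ (k : ℕ) (hk : k < C.len),
      σ (PGloc (C.v ⟨k, hk⟩)) ≠ decide (C.tail ⟨k, hk⟩ ∈ S) := by
    intro k
    induction k with
    | zero => intro hk; rw [hfirst _ rfl]; exact hb
    | succ k ih =>
      intro hk
      have step := (C.eq_tail_or_eq_head h ⟨k, by omega⟩).resolve_left (ih (by omega))
      simp only [Nat.mod_eq_of_lt hk] at step
      rw [step, decide_eq_true (hhead _ hk.ne), decide_eq_false (htail _ k.succ_ne_zero)]
      decide
  have hpos := C.pos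
  have hn : C.len - 1 + 1 = C.len := by omega
  have step := (C.eq_tail_or_eq_head h ⟨C.len - 1, by omega⟩).resolve_left (walk _ _)
  rw [hlast _ hn] at step
  simp only [hn, Nat.mod_self] at step
  exact hb step

end PGCycle

/-- Forcing lemma: for any cycle `C` in the pseudo-graph `G_Φ` starting at vertex
`v` and any bit `b`, there are disjoint subsets `S₀, S₁ ⊆ lab(C)`, each of size at
most `|C|+1`, such that in any correct representation under `Φ` of a set `S` with
`S₁ ⊆ S ⊆ complement of S₀`, the memory location of `v` must hold the value `b`.
Moreover if `b = 0` then `|S₁| = |C|-1` and if `b = 1` then `|S₁| = |C|+1`. -/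
theorem forcing_lemma {m s : ℕ} (Φ : SysTwoProbe m s) (PG : PseudoGraph m s Φ)
    (C : PGCycle PG) (b : Bool) :
    ∃ S0 S1 : Finset (Fin m),
      (↑S0 : Set (Fin m)) ⊆ C.lab ∧ (↑S1 : Set (Fin m)) ⊆ C.lab ∧
      Disjoint S0 S1 ∧
      S0.card ≤ C.len + 1 ∧ S1.card ≤ C.len + 1 ∧
      (b = false → S1.card = C.len - 1) ∧ (b = true → S1.card = C.len + 1) ∧
      ∀ S : Finset (Fin m), S1 ⊆ S → (∀ x ∈ S0, x ∉ S) →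
        ∀ σ : Fin s → Bool, Φ.Correct σ S → σ (PGloc C.start) = b := by
  have hpos := C.pos
  let first : Fin C.len := ⟨0, hpos⟩
  let last : Fin C.len := ⟨C.len - 1, by omega⟩
  have hf : ∀ i : Fin C.len, i.val = 0 → i = first := fun i hi => Fin.ext hi
  have hl : ∀ i : Fin C.len, i.val + 1 = C.len → i = last :=
    fun i hi => Fin.ext (show i.val = C.len - 1 by omega)
  let T : Finset (Fin m) := (Finset.univ.erase first).image C.tail
  let H : Finset (Fin m) := (Finset.univ.erase last).image C.head
  let E : Finset (Fin m) := {C.tail first, C.head last}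
  have memT : ∀ i : Fin C.len, i.val ≠ 0 → C.tail i ∈ T := fun i hi =>
    Finset.mem_image_of_mem _ (Finset.mem_erase.2
      ⟨fun h => hi (congrArg Fin.val h), Finset.mem_univ _⟩)
  have memH : ∀ i : Fin C.len, i.val + 1 ≠ C.len → C.head i ∈ H := fun i hi =>
    Finset.mem_image_of_mem _ (Finset.mem_erase.2
      ⟨fun h => hi (by rw [h]; show C.len - 1 + 1 = C.len; omega), Finset.mem_univ _⟩)
  have cardT : T.card = C.len - 1 := by
    simp [T, Finset.card_image_of_injective _ C.tail_injective]
  have cardH : H.card = C.len - 1 := by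
    simp [H, Finset.card_image_of_injective _ C.head_injective]
  have cardE : E.card = 2 := Finset.card_pair (C.tail_ne_head _ _)
  have labT : (↑T : Set (Fin m)) ⊆ C.lab := by
    intro x hx
    obtain ⟨i, -, rfl⟩ := Finset.mem_image.1 hx
    exact C.tail_mem_lab i
  have labH : (↑H : Set (Fin m)) ⊆ C.lab := by
    intro x hx
    obtain ⟨i, -, rfl⟩ := Finset.mem_image.1 hx
    exact C.head_mem_lab i
  have labE : (↑E : Set (Fin m)) ⊆ C.lab := by
    intro x hx
    simp only [E, Finset.coe_pair, Set.mem_insert_iff, Set.mem_singleton_iff] at hx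
    rcases hx with rfl | rfl
    · exact C.tail_mem_lab _
    · exact C.head_mem_lab _
  have disjTH : Disjoint T H := by
    simp only [T, H, Finset.disjoint_left, Finset.mem_image]
    rintro _ ⟨i, -, rfl⟩ ⟨j, -, hj⟩
    exact C.tail_ne_head i j hj.symm
  have disjTE : Disjoint T E := by
    simp only [T, E, Finset.disjoint_left, Finset.mem_image, Finset.mem_insert,
      Finset.mem_singleton]
    rintro _ ⟨i, hi, rfl⟩ (h | h)
    · exact Finset.ne_of_mem_erase hi (C.tail_injective h)
    · exact C.tail_ne_head _ _ h
  have disjHE : Disjoint H E := by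
    simp only [H, E, Finset.disjoint_left, Finset.mem_image, Finset.mem_insert,
      Finset.mem_singleton]
    rintro _ ⟨i, hi, rfl⟩ (h | h)
    · exact C.tail_ne_head _ _ h.symm
    · exact Finset.ne_of_mem_erase hi (C.head_injective h)
  have firstE : C.tail first ∈ E := by simp [E]
  have lastE : C.head last ∈ E := by simp [E]
  have cardTE := Finset.card_union_of_disjoint disjTE
  have cardHE := Finset.card_union_of_disjoint disjHE
  cases b with
  | false =>
    refine ⟨T ∪ E, H, by simp [labT, labE], labH,
      Finset.disjoint_union_left.2 ⟨disjTH, disjHE.symm⟩, by omega, by omega,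
      fun _ => cardH, by simp, fun S hS1 hS0 σ hσ => ?_⟩
    refine C.start_eq_of_correct hσ false (fun i hi => hS1 (memH i hi))
      (fun i hi => hS0 _ (Finset.mem_union_left _ (memT i hi))) (fun i hi => ?_) (fun i hi => ?_)
    · rw [hf i hi]
      exact decide_eq_false (hS0 _ (Finset.mem_union_right _ firstE))
    · rw [hl i hi]
      exact decide_eq_false (hS0 _ (Finset.mem_union_right _ lastE))
  | true =>
    refine ⟨T, H ∪ E, labT, by simp [labH, labE],
      Finset.disjoint_union_right.2 ⟨disjTH, disjTE⟩, by omega, by omega,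
      by simp, fun _ => by omega, fun S hS1 hS0 σ hσ => ?_⟩
    refine C.start_eq_of_correct hσ true (fun i hi => hS1 (Finset.mem_union_left _ (memH i hi)))
      (fun i hi => hS0 _ (memT i hi)) (fun i hi => ?_) (fun i hi => ?_)
    · rw [hf i hi]
      exact decide_eq_true (hS1 (Finset.mem_union_right _ firstE))
    · rw [hl i hi]
      exact decide_eq_true (hS1 (Finset.mem_union_right _ lastE))
end

section
/- Let Φ be a systematic two-probe scheme over memory [s] for universe [m] such that for every set S ⊆ [m] of size at most 2k there exists a memory assignment under which Φ answers all membership queries for S correctly. Then the pseudo-graph G_Φ does not contain two edge-disjoint cycles, each of length at most k, that have a vertex in common. -/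
/-- Under a correct memory assignment, each pseudo-edge is satisfied at one of its endpoints. -/
theorem SysTwoProbe.Correct.pair {m s : ℕ} {Φ : SysTwoProbe m s} {σ : Fin s → Bool}
    {S : Finset (Fin m)} (hσ : Φ.Correct σ S) {x y : Fin m} (hxy : Φ.fst x = Φ.fst y) :
    σ (Φ.snd0 x) = decide (x ∈ S) ∨ σ (Φ.snd1 y) = decide (y ∈ S) := by
  have hx := hσ x
  have hy := hσ y
  unfold SysTwoProbe.answer at hx hy
  rw [← hxy] at hy
  cases hc : σ (Φ.fst x)
  · left
    rw [Bool.eq_iff_iff, decide_eq_true_iff]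
    simpa [hc] using hx
  · right
    rw [Bool.eq_iff_iff, decide_eq_true_iff]
    simpa [hc] using hy

/-- The labels of two pseudo-edges are disjoint unless the pseudo-edges coincide. -/
theorem PseudoGraph.eq_of_common_label {m s : ℕ} {Φ : SysTwoProbe m s} (PG : PseudoGraph m s Φ)
    {p q : Fin m × Fin m} (hp : p ∈ PG.pairs) (hq : q ∈ PG.pairs) {x : Fin m}
    (hxp : x = p.1 ∨ x = p.2) (hxq : x = q.1 ∨ x = q.2) : p = q := by
  by_contra hne
  have := PG.disjointPairs p hp q hq hne
  grind

/-- Traversing a cycle from any of its vertices: `w t` is the location of the `t`-th vertex, and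
`a t`, `b t` are the labels of the `t`-th edge at its initial and terminal vertex. -/
theorem PGCycle.exists_closed_walk {m s : ℕ} {Φ : SysTwoProbe m s} {PG : PseudoGraph m s Φ}
    (C : PGCycle PG) (i₀ : Fin C.len) :
    ∃ (w : ℕ → Fin s) (a b : ℕ → Fin m) (f : ℕ → Fin C.len),
      w 0 = PGloc (C.v i₀) ∧ w C.len = w 0 ∧
      (∀ t < C.len, ∀ u < C.len, f t = f u → t = u) ∧
      (∀ t, a t = (C.e (f t)).1 ∨ a t = (C.e (f t)).2) ∧
      (∀ t, b t = (C.e (f t)).1 ∨ b t = (C.e (f t)).2) ∧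
      (∀ t, a t ≠ b t) ∧
      ∀ (σ : Fin s → Bool) (S : Finset (Fin m)), Φ.Correct σ S →
        ∀ t, σ (w t) = decide (a t ∈ S) ∨ σ (w (t + 1)) = decide (b t ∈ S) := by
  let f : ℕ → Fin C.len := fun t => ⟨(i₀.val + t) % C.len, Nat.mod_lt _ C.pos⟩
  have key : ∀ t, ∃ a b : Fin m,
      (a = (C.e (f t)).1 ∨ a = (C.e (f t)).2) ∧ (b = (C.e (f t)).1 ∨ b = (C.e (f t)).2) ∧
      a ≠ b ∧ ∀ (σ : Fin s → Bool) (S : Finset (Fin m)), Φ.Correct σ S →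
        σ (PGloc (C.v (f t))) = decide (a ∈ S) ∨
          σ (PGloc (C.v (f (t + 1)))) = decide (b ∈ S) := by
    intro t
    have hf : (⟨((f t).val + 1) % C.len, Nat.mod_lt _ C.pos⟩ : Fin C.len) = f (t + 1) := by
      apply Fin.ext
      simp [f, Nat.add_assoc]
    have hne := PG.ne _ (C.mem (f t))
    have hcol := PG.sameColor _ (C.mem (f t))
    rcases C.conn (f t) with ⟨h0, h1⟩ | ⟨h0, h1⟩ <;> rw [hf] at h1
    · refine ⟨_, _, Or.inl rfl, Or.inr rfl, hne, fun σ S hσ => ?_⟩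
      rw [h0, h1]
      exact hσ.pair hcol
    · refine ⟨_, _, Or.inr rfl, Or.inl rfl, hne.symm, fun σ S hσ => ?_⟩
      rw [h0, h1]
      exact (hσ.pair hcol).symm
  choose a b ha hb hab hσ using key
  refine ⟨fun t => PGloc (C.v (f t)), a, b, f, ?_, ?_, ?_, ha, hb, hab,
    fun σ S h t => hσ t σ S h⟩
  · have h0 : f 0 = i₀ := Fin.ext (Nat.mod_eq_of_lt i₀.isLt)
    exact congrArg (fun x => PGloc (C.v x)) h0
  · have hL : f C.len = f 0 := Fin.ext (Nat.add_mod_right i₀.val C.len)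
    exact congrArg (fun x => PGloc (C.v x)) hL
  · intro t ht u hu htu
    have h1 : (i₀.val + t) ≡ (i₀.val + u) [MOD C.len] := congrArg Fin.val htu
    have h2 : t ≡ u [MOD C.len] := Nat.ModEq.add_left_cancel' _ h1
    rwa [Nat.ModEq, Nat.mod_eq_of_lt ht, Nat.mod_eq_of_lt hu] at h2

/-- If every edge of a closed walk is satisfied at one of its endpoints, the initial labels demand
`c`, and all terminal labels but the last one demand `!c`, then the base point has value `c`. -/
theorem closed_walk_forces_base {V : Type*} {σ : V → Bool} {w : ℕ → V} {α β : ℕ → Bool} {n : ℕ}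
    {c : Bool} (hw : w (n + 1) = w 0) (hsat : ∀ t, σ (w t) = α t ∨ σ (w (t + 1)) = β t)
    (hα : ∀ t ≤ n, α t = c) (hβ : ∀ t < n, β t = !c) (hn : β n = c) : σ (w 0) = c := by
  by_contra h0
  have hall : ∀ t ≤ n, σ (w t) ≠ c := by
    intro t
    induction t with
    | zero => exact fun _ => h0
    | succ t ih =>
      intro ht
      have h1 := ih (by omega)
      rcases hsat t with h2 | h2
      · exact absurd (h2.trans (hα t (by omega))) h1
      · rw [h2, hβ t (by omega)]
        simp
  rcases hsat n with h2 | h2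
  · exact hall n le_rfl (h2.trans (hα n le_rfl))
  · exact h0 (hw ▸ h2.trans hn)

/-- If a systematic two-probe scheme can store (with some correct memory
assignment) every set of size at most `2k`, then its pseudo-graph does not
contain two edge-disjoint cycles, each of length at most `k`, having a vertex in
common. -/
theorem no_two_short_intersecting_cycles {m s k : ℕ} (Φ : SysTwoProbe m s)
    (PG : PseudoGraph m s Φ)
    (h : ∀ S : Finset (Fin m), S.card ≤ 2 * k → ∃ σ : Fin s → Bool, Φ.Correct σ S) :
    ¬ ∃ C1 C2 : PGCycle PG, C1.len ≤ k ∧ C2.len ≤ k ∧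
      (∀ (i : Fin C1.len) (j : Fin C2.len), C1.e i ≠ C2.e j) ∧
      (∃ (i : Fin C1.len) (j : Fin C2.len), C1.v i = C2.v j) := by
  classical
  rintro ⟨C, D, hC, hD, hdisj, i, j, hij⟩
  obtain ⟨w, a, b, f, hw0, hwL, hf, ha, hb, hab, hσ⟩ := C.exists_closed_walk i
  obtain ⟨w', a', b', f', hw0', hwL', hf', ha', hb', hab', hσ'⟩ := D.exists_closed_walk j
  obtain ⟨n, hn⟩ : ∃ n, C.len = n + 1 := Nat.exists_eq_add_one.2 C.pos
  obtain ⟨n', hn'⟩ : ∃ n, D.len = n + 1 := Nat.exists_eq_add_one.2 D.pos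
  have sepC : ∀ t ≤ n, ∀ u ≤ n, ∀ x, (x = (C.e (f t)).1 ∨ x = (C.e (f t)).2) →
      (x = (C.e (f u)).1 ∨ x = (C.e (f u)).2) → t = u := fun t ht u hu x hx hx' =>
    hf t (by omega) u (by omega)
      (C.eInj (PG.eq_of_common_label (C.mem _) (C.mem _) hx hx'))
  have sepD : ∀ t ≤ n', ∀ u ≤ n', ∀ x, (x = (D.e (f' t)).1 ∨ x = (D.e (f' t)).2) →
      (x = (D.e (f' u)).1 ∨ x = (D.e (f' u)).2) → t = u := fun t ht u hu x hx hx' =>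
    hf' t (by omega) u (by omega)
      (D.eInj (PG.eq_of_common_label (D.mem _) (D.mem _) hx hx'))
  have sepCD : ∀ t u x, (x = (C.e (f t)).1 ∨ x = (C.e (f t)).2) →
      ¬ (x = (D.e (f' u)).1 ∨ x = (D.e (f' u)).2) := fun t u x hx hx' =>
    hdisj _ _ (PG.eq_of_common_label (C.mem _) (D.mem _) hx hx')
  let S : Finset (Fin m) :=
    insert (b n) ((Finset.range (n + 1)).image a) ∪ (Finset.range n').image b'
  have memS : ∀ x, x ∈ S ↔ (x = b n ∨ ∃ t ≤ n, a t = x) ∨ ∃ t < n', b' t = x := by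
    intro x
    simp [S, or_assoc]
  have hS : S.card ≤ 2 * k := by
    have h1 : S.card ≤ _ := Finset.card_union_le _ _
    have h2 := Finset.card_insert_le (b n) ((Finset.range (n + 1)).image a)
    have h3 : ((Finset.range (n + 1)).image a).card ≤ _ := Finset.card_image_le
    have h4 : ((Finset.range n').image b').card ≤ _ := Finset.card_image_le
    rw [Finset.card_range] at h3 h4
    omega
  obtain ⟨σ, hcor⟩ := h S hS
  have hbase : σ (w 0) = true := by
    refine closed_walk_forces_base (hn ▸ hwL) (hσ σ S hcor) ?_ ?_ ?_
    · exact fun t ht => decide_eq_true ((memS _).2 (Or.inl (Or.inr ⟨t, ht, rfl⟩)))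
    · refine fun t ht => decide_eq_false fun hmem => ?_
      rcases (memS _).1 hmem with (h1 | ⟨u, hu, h1⟩) | ⟨u, -, h1⟩
      · exact ht.ne (sepC t ht.le n le_rfl _ (hb t) (h1 ▸ hb n))
      · have htu := sepC t ht.le u hu _ (hb t) (h1 ▸ ha u)
        exact hab t (htu ▸ h1)
      · exact sepCD t u _ (hb t) (h1 ▸ hb' u)
    · exact decide_eq_true ((memS _).2 (Or.inl (Or.inl rfl)))
  have hbase' : σ (w' 0) = false := by
    refine closed_walk_forces_base (hn' ▸ hwL') (hσ' σ S hcor) ?_ ?_ ?_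
    · refine fun t ht => decide_eq_false fun hmem => ?_
      rcases (memS _).1 hmem with (h1 | ⟨u, -, h1⟩) | ⟨u, hu, h1⟩
      · exact sepCD n t _ (hb n) (h1 ▸ ha' t)
      · exact sepCD u t _ (ha u) (h1 ▸ ha' t)
      · have htu := sepD t ht u hu.le _ (ha' t) (h1 ▸ hb' u)
        subst htu
        exact hab' t h1.symm
    · exact fun t ht => decide_eq_true ((memS _).2 (Or.inr ⟨t, ht, rfl⟩))
    · refine decide_eq_false fun hmem => ?_
      rcases (memS _).1 hmem with (h1 | ⟨u, -, h1⟩) | ⟨u, hu, h1⟩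
      · exact sepCD n n' _ (hb n) (h1 ▸ hb' n')
      · exact sepCD u n' _ (ha u) (h1 ▸ hb' n')
      · exact hu.ne' (sepD n' le_rfl u hu.le _ (hb' n') (h1 ▸ hb' u))
  rw [hw0, hij, ← hw0', hbase'] at hbase
  exact Bool.false_ne_true hbase
end

section
/- Let n ≥ 4 be an integer and let G be a bipartite graph with average degree d ≥ 2 and girth greater than ⌊n/2⌋. Then d ≤ (|V(G)|/2)^{1/⌊n/4⌋} + 1. -/
/-- The function `x ↦ x log (x - 1)` is convex on `[2, ∞)`. -/
theorem Real.convexOn_mul_log_sub_one :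
    ConvexOn ℝ (Set.Ici 2) fun x : ℝ => x * Real.log (x - 1) := by
  refine convexOn_of_hasDerivWithinAt2_nonneg (convex_Ici 2)
    (f' := fun x => Real.log (x - 1) + x / (x - 1))
    (f'' := fun x => (x - 2) / (x - 1) ^ 2) ?_ ?_ ?_ ?_
  · intro x hx
    have hx : (2 : ℝ) ≤ x := hx
    have : x - 1 ≠ 0 := by linarith
    fun_prop (disch := assumption)
  · intro x hx
    rw [interior_Ici] at hx
    have hx : (2 : ℝ) < x := hx
    have h0 : x - 1 ≠ 0 := by linarith
    refine HasDerivAt.hasDerivWithinAt ?_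
    convert! (hasDerivAt_id x).mul (((hasDerivAt_id x).sub_const 1).log h0) using 1
    simp [div_eq_mul_inv]
  · intro x hx
    rw [interior_Ici] at hx
    have hx : (2 : ℝ) < x := hx
    have h0 : x - 1 ≠ 0 := by linarith
    refine HasDerivAt.hasDerivWithinAt ?_
    have hs := (hasDerivAt_id x).sub_const 1
    convert! (hs.log h0).add ((hasDerivAt_id x).div hs h0) using 1
    simp only [id]
    field_simp
    ring
  · intro x hx
    rw [interior_Ici] at hx
    have hx : (2 : ℝ) < x := hx
    have : 0 ≤ x - 2 := by linarith
    positivity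

namespace SimpleGraph

open Finset

universe u

variable {V : Type u} {G : SimpleGraph V}

/-- Two non-backtracking walks with the same ends and of total length less than the girth
coincide. -/
theorem Walk.eq_of_isChain_edges_of_lt_egirth {u v : V} {p q : G.Walk u v}
    (hp : p.edges.IsChain (· ≠ ·)) (hq : q.edges.IsChain (· ≠ ·))
    (hlen : ((p.length + q.length : ℕ) : ℕ∞) < G.egirth) : p = q := by
  classical
  let H := fromEdgeSet {e | e ∈ p.edges ++ q.edges}
  have hmem : ∀ e, e ∈ H.edgeSet → e ∈ p.edges ++ q.edges := by
    intro e he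
    rw [edgeSet_fromEdgeSet] at he
    exact he.1
  have hsub : ∀ e ∈ p.edges ++ q.edges, e ∈ G.edgeSet := by
    intro e he
    rcases List.mem_append.1 he with he | he
    · exact p.edges_subset_edgeSet he
    · exact q.edges_subset_edgeSet he
  have hmem' : ∀ e ∈ p.edges ++ q.edges, e ∈ H.edgeSet := by
    intro e he
    rw [edgeSet_fromEdgeSet]
    exact ⟨he, G.not_isDiag_of_mem_edgeSet (hsub e he)⟩
  have hHG : H ≤ G := edgeSet_subset_edgeSet.1 fun e he => hsub e (hmem e he)
  have hacyc : H.IsAcyclic := by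
    intro a c hc
    have hle : c.length ≤ p.length + q.length := by
      rw [← c.length_edges, ← p.length_edges, ← q.length_edges, ← List.length_append]
      exact (List.subperm_of_subset hc.edges_nodup
        fun e he => hmem e (c.edges_subset_edgeSet he)).length_le
    have hg := egirth_le_length (hc.mapLe hHG)
    rw [Walk.length_map] at hg
    exact absurd (hlen.trans_le hg) (not_lt.2 (Nat.cast_le.2 hle))
  have hpH : ∀ e ∈ p.edges, e ∈ H.edgeSet := fun e he => hmem' e (List.mem_append_left _ he)
  have hqH : ∀ e ∈ q.edges, e ∈ H.edgeSet := fun e he => hmem' e (List.mem_append_right _ he)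
  have hpath := (hacyc.subsingleton_path u v).elim
    ⟨p.transfer H hpH, (hacyc.isPath_iff_isChain _).2 (by simpa using hp)⟩
    ⟨q.transfer H hqH, (hacyc.isPath_iff_isChain _).2 (by simpa using hq)⟩
  have hsupp := congrArg (fun r : H.Path u v => r.1.support) hpath
  exact Walk.ext_support (by simpa using hsupp)

/-- The girth does not decrease when passing to an induced subgraph. -/
theorem egirth_le_egirth_induce (G : SimpleGraph V) (s : Set V) :
    G.egirth ≤ (G.induce s).egirth := by
  refine le_egirth.2 fun a w hw => ?_
  have h := egirth_le_length (hw.map (f := (Embedding.induce s).toHom) Subtype.val_injective)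
  rwa [Walk.length_map] at h

section

variable [Fintype V] [DecidableRel G.Adj]

theorem sum_neighborFinset_comm (f : V → V → ℝ) :
    ∑ v, ∑ u ∈ G.neighborFinset v, f u v = ∑ v, ∑ u ∈ G.neighborFinset v, f v u :=
  sum_comm' (by simp [adj_comm])

/-- The convexity bound on the weighted sum of logarithms of the branching numbers. -/
theorem sum_degree_mul_log_avg_le [Nonempty V] (hdeg : ∀ v, 2 ≤ G.degree v) :
    (∑ v, (G.degree v : ℝ)) * Real.log ((∑ v, (G.degree v : ℝ)) / Fintype.card V - 1) ≤
      ∑ v, (G.degree v : ℝ) * Real.log ((G.degree v : ℝ) - 1) := by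
  have hN : (0 : ℝ) < Fintype.card V := Nat.cast_pos.2 Fintype.card_pos
  have hJ := Real.convexOn_mul_log_sub_one.map_sum_le (t := univ)
    (w := fun _ : V => (Fintype.card V : ℝ)⁻¹) (p := fun v => (G.degree v : ℝ))
    (fun _ _ => (inv_pos.2 hN).le) (by simp [hN.ne'])
    (fun v _ => by simpa using hdeg v)
  simp only [smul_eq_mul, ← mul_sum] at hJ
  rw [mul_assoc] at hJ
  have := le_of_mul_le_mul_left hJ (inv_pos.2 hN)
  rwa [inv_mul_eq_div] at this

variable [DecidableEq V]

variable (G) in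
/-- The set of last vertices of non-backtracking walks which start with the step from `u` to `v`
and continue with `l` further steps. -/
def nonbacktrackingEnds : ℕ → V → V → Finset V
  | 0, _, v => {v}
  | l + 1, u, v => ((G.neighborFinset v).erase u).biUnion fun w => nonbacktrackingEnds l v w

theorem exists_walk_of_mem_nonbacktrackingEnds {l : ℕ} {u v x : V}
    (hx : x ∈ G.nonbacktrackingEnds l u v) :
    ∃ p : G.Walk v x, p.length = l ∧ (s(u, v) :: p.edges).IsChain (· ≠ ·) := by
  induction l generalizing u v with
  | zero =>
    obtain rfl : x = v := by simpa [nonbacktrackingEnds] using hx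
    exact ⟨.nil, by simp⟩
  | succ l ih =>
    simp only [nonbacktrackingEnds, mem_biUnion, mem_erase, mem_neighborFinset] at hx
    obtain ⟨w, ⟨hwu, hvw⟩, hx⟩ := hx
    obtain ⟨p, hp, hch⟩ := ih hx
    refine ⟨.cons hvw p, by simp [hp], ?_⟩
    rw [Walk.edges_cons, List.isChain_cons_cons]
    refine ⟨?_, hch⟩
    rw [Sym2.eq_swap, Ne, Sym2.congr_right]
    exact hwu.symm

theorem card_nonbacktrackingEnds_succ {l : ℕ} (hl : ((2 * (l + 1) : ℕ) : ℕ∞) < G.egirth)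
    (u v : V) :
    #(G.nonbacktrackingEnds (l + 1) u v) =
      ∑ w ∈ (G.neighborFinset v).erase u, #(G.nonbacktrackingEnds l v w) := by
  refine card_biUnion fun w hw w' hw' hne => Finset.disjoint_left.2 fun x hx hx' => hne ?_
  simp only [mem_coe, mem_erase, mem_neighborFinset] at hw hw'
  obtain ⟨p, hp, hpc⟩ := exists_walk_of_mem_nonbacktrackingEnds hx
  obtain ⟨q, hq, hqc⟩ := exists_walk_of_mem_nonbacktrackingEnds hx'
  have h : Walk.cons hw.2 p = Walk.cons hw'.2 q := by
    refine Walk.eq_of_isChain_edges_of_lt_egirth (by simpa using hpc) (by simpa using hqc) ?_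
    convert hl using 2
    simp only [Walk.length_cons]
    omega
  injection h

theorem nonbacktrackingEnds_nonempty (hdeg : ∀ v, 2 ≤ G.degree v) (l : ℕ) (u v : V) :
    (G.nonbacktrackingEnds l u v).Nonempty := by
  induction l generalizing u v with
  | zero => exact singleton_nonempty v
  | succ l ih =>
    have : ((G.neighborFinset v).erase u).Nonempty := by
      rw [← card_pos]
      have := pred_card_le_card_erase (s := G.neighborFinset v) (a := u)
      have := hdeg v
      rw [← card_neighborFinset_eq_degree] at this
      omega
    exact this.biUnion fun w _ => ih v w

theorem disjoint_nonbacktrackingEnds (hbip : G.Colorable 2) (l : ℕ) {u v : V} (huv : G.Adj u v) :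
    Disjoint (G.nonbacktrackingEnds l u v) (G.nonbacktrackingEnds l v u) := by
  refine Finset.disjoint_left.2 fun x hx hx' => ?_
  obtain ⟨p, hp, -⟩ := exists_walk_of_mem_nonbacktrackingEnds hx
  obtain ⟨q, hq, -⟩ := exists_walk_of_mem_nonbacktrackingEnds hx'
  have hodd : Odd (Walk.cons huv (p.append q.reverse)).length := by
    simp only [Walk.length_cons, Walk.length_append, Walk.length_reverse, hp, hq]
    exact ⟨l, by ring⟩
  have h3 := (Walk.three_le_chromaticNumber_of_odd_loop _ hodd).trans hbip.chromaticNumber_le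
  exact absurd h3 (by decide)

theorem log_card_add_log_card_nonbacktrackingEnds_le (hbip : G.Colorable 2)
    (hdeg : ∀ v, 2 ≤ G.degree v) (l : ℕ) {u v : V} (huv : G.Adj u v) :
    Real.log #(G.nonbacktrackingEnds l u v) + Real.log #(G.nonbacktrackingEnds l v u) ≤
      2 * Real.log ((Fintype.card V : ℝ) / 2) := by
  have ha : (0 : ℝ) < #(G.nonbacktrackingEnds l u v) :=
    Nat.cast_pos.2 (nonbacktrackingEnds_nonempty hdeg l u v).card_pos
  have hb : (0 : ℝ) < #(G.nonbacktrackingEnds l v u) :=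
    Nat.cast_pos.2 (nonbacktrackingEnds_nonempty hdeg l v u).card_pos
  have hab : (#(G.nonbacktrackingEnds l u v) : ℝ) + #(G.nonbacktrackingEnds l v u) ≤
      Fintype.card V := by
    rw [← Nat.cast_add, ← card_union_of_disjoint (disjoint_nonbacktrackingEnds hbip l huv)]
    exact Nat.cast_le.2 (card_le_univ _)
  rw [← Real.log_mul ha.ne' hb.ne', ← Nat.cast_two (R := ℝ), ← Real.log_pow, Nat.cast_two]
  refine Real.log_le_log (by positivity) ?_
  nlinarith [sq_nonneg ((#(G.nonbacktrackingEnds l u v) : ℝ) - #(G.nonbacktrackingEnds l v u))]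

theorem sum_log_card_nonbacktrackingEnds_le (hbip : G.Colorable 2)
    (hdeg : ∀ v, 2 ≤ G.degree v) (l : ℕ) :
    ∑ v, ∑ u ∈ G.neighborFinset v, Real.log #(G.nonbacktrackingEnds l u v) ≤
      (∑ v, (G.degree v : ℝ)) * Real.log ((Fintype.card V : ℝ) / 2) := by
  have h : ∑ v, ∑ u ∈ G.neighborFinset v, (Real.log #(G.nonbacktrackingEnds l u v) +
      Real.log #(G.nonbacktrackingEnds l v u)) ≤
      ∑ v, ∑ u ∈ G.neighborFinset v, 2 * Real.log ((Fintype.card V : ℝ) / 2) :=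
    sum_le_sum fun v _ => sum_le_sum fun u hu =>
      log_card_add_log_card_nonbacktrackingEnds_le hbip hdeg l
        ((mem_neighborFinset _ _ _).1 hu).symm
  simp only [sum_add_distrib, sum_const, card_neighborFinset_eq_degree, nsmul_eq_mul,
    ← sum_mul] at h
  rw [← sum_neighborFinset_comm (fun u v => Real.log #(G.nonbacktrackingEnds l u v))] at h
  linarith

theorem log_card_nonbacktrackingEnds_succ_ge (hdeg : ∀ v, 2 ≤ G.degree v) {l : ℕ}
    (hl : ((2 * (l + 1) : ℕ) : ℕ∞) < G.egirth) {u v : V} (huv : G.Adj u v) :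
    Real.log ((G.degree v : ℝ) - 1) + (∑ w ∈ (G.neighborFinset v).erase u,
      Real.log #(G.nonbacktrackingEnds l v w)) / ((G.degree v : ℝ) - 1) ≤
      Real.log #(G.nonbacktrackingEnds (l + 1) u v) := by
  have hD : (0 : ℝ) < (G.degree v : ℝ) - 1 := by
    have : (2 : ℝ) ≤ G.degree v := by exact_mod_cast hdeg v
    linarith
  have hcard : (#((G.neighborFinset v).erase u) : ℝ) = (G.degree v : ℝ) - 1 := by
    rw [card_erase_of_mem ((mem_neighborFinset _ _ _).2 huv.symm), card_neighborFinset_eq_degree,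
      Nat.cast_sub (by linarith [hdeg v]), Nat.cast_one]
  have hpos : ∀ w, (0 : ℝ) < #(G.nonbacktrackingEnds l v w) := fun w =>
    Nat.cast_pos.2 (nonbacktrackingEnds_nonempty hdeg l v w).card_pos
  have hpos' :
      (0 : ℝ) < ∑ w ∈ (G.neighborFinset v).erase u, (#(G.nonbacktrackingEnds l v w) : ℝ) :=
    sum_pos (fun w _ => hpos w) (by
      rw [← card_pos, ← Nat.cast_pos (α := ℝ), hcard]
      exact hD)
  have hJ := strictConcaveOn_log_Ioi.concaveOn.le_map_sum
    (t := (G.neighborFinset v).erase u) (w := fun _ => ((G.degree v : ℝ) - 1)⁻¹)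
    (p := fun w => (#(G.nonbacktrackingEnds l v w) : ℝ))
    (fun _ _ => (inv_pos.2 hD).le)
    (by rw [sum_const, nsmul_eq_mul, hcard, mul_inv_cancel₀ hD.ne']) (fun w _ => hpos w)
  simp only [smul_eq_mul, ← mul_sum] at hJ
  rw [Real.log_mul (inv_ne_zero hD.ne') hpos'.ne', Real.log_inv, inv_mul_eq_div] at hJ
  rw [card_nonbacktrackingEnds_succ hl, Nat.cast_sum]
  linarith

theorem sum_log_card_nonbacktrackingEnds_ge (hdeg : ∀ v, 2 ≤ G.degree v) (l : ℕ)
    (hl : ((2 * l : ℕ) : ℕ∞) < G.egirth) :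
    l * ∑ v, (G.degree v : ℝ) * Real.log ((G.degree v : ℝ) - 1) ≤
      ∑ v, ∑ u ∈ G.neighborFinset v, Real.log #(G.nonbacktrackingEnds l u v) := by
  induction l with
  | zero => simp [nonbacktrackingEnds]
  | succ l ih =>
    have hl' : ((2 * l : ℕ) : ℕ∞) < G.egirth :=
      lt_of_le_of_lt (Nat.cast_le.2 (by omega)) hl
    have hstep : ∀ v, (G.degree v : ℝ) * Real.log ((G.degree v : ℝ) - 1) +
        ∑ u ∈ G.neighborFinset v, Real.log #(G.nonbacktrackingEnds l v u) ≤
        ∑ u ∈ G.neighborFinset v, Real.log #(G.nonbacktrackingEnds (l + 1) u v) := by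
      intro v
      have hD : (0 : ℝ) < (G.degree v : ℝ) - 1 := by
        have : (2 : ℝ) ≤ G.degree v := by exact_mod_cast hdeg v
        linarith
      refine le_trans (le_of_eq ?_) (sum_le_sum fun u hu =>
        log_card_nonbacktrackingEnds_succ_ge hdeg hl ((mem_neighborFinset _ _ _).1 hu).symm)
      rw [sum_add_distrib, sum_const, card_neighborFinset_eq_degree, nsmul_eq_mul, ← sum_div]
      congr 1
      rw [eq_div_iff hD.ne', sum_congr rfl fun u hu => sum_erase_eq_sub hu, sum_sub_distrib,
        sum_const, card_neighborFinset_eq_degree, nsmul_eq_mul]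
      ring
    have hsum := sum_le_sum fun v (_ : v ∈ univ) => hstep v
    rw [sum_add_distrib,
      ← sum_neighborFinset_comm (fun u v => Real.log #(G.nonbacktrackingEnds l u v))] at hsum
    have := ih hl'
    push_cast
    linarith

theorem avg_degree_sub_one_pow_le_of_two_le_degree [Nonempty V] (hbip : G.Colorable 2)
    (hdeg : ∀ v, 2 ≤ G.degree v) (k : ℕ) (hk : ((2 * k : ℕ) : ℕ∞) < G.egirth) :
    (2 * (#G.edgeFinset : ℝ) / Fintype.card V - 1) ^ k ≤ (Fintype.card V : ℝ) / 2 := by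
  have hN : (0 : ℝ) < Fintype.card V := Nat.cast_pos.2 Fintype.card_pos
  have hE : ∑ v, (G.degree v : ℝ) = 2 * (#G.edgeFinset : ℝ) := by
    exact_mod_cast G.sum_degrees_eq_twice_card_edges
  have hND : 2 * (Fintype.card V : ℝ) ≤ ∑ v, (G.degree v : ℝ) := by
    have : ∑ _v : V, (2 : ℝ) ≤ ∑ v, (G.degree v : ℝ) :=
      sum_le_sum fun v _ => by exact_mod_cast hdeg v
    simpa [mul_comm] using this
  rw [← hE]
  have hlow := sum_log_card_nonbacktrackingEnds_ge hdeg k hk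
  have hup := sum_log_card_nonbacktrackingEnds_le hbip hdeg k
  have hconv := mul_le_mul_of_nonneg_left (sum_degree_mul_log_avg_le hdeg)
    (Nat.cast_nonneg (α := ℝ) k)
  set D := ∑ v, (G.degree v : ℝ)
  have hD : 0 < D := by linarith
  have havg : 0 < D / Fintype.card V - 1 := by
    have : 2 ≤ D / Fintype.card V := (le_div_iff₀ hN).2 hND
    linarith
  rw [← Real.log_le_log_iff (by positivity) (by positivity), Real.log_pow]
  refine le_of_mul_le_mul_left ?_ hD
  linarith

end

/-- **Moore bound** for bipartite graphs of average degree at least two and girth greater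
than `2 * k`, in a weak form. -/
theorem avg_degree_sub_one_pow_le [Fintype V] (hbip : G.Colorable 2) (k : ℕ)
    (hk : ((2 * k : ℕ) : ℕ∞) < G.egirth) (hV : 0 < Fintype.card V)
    (hE : Fintype.card V ≤ G.edgeSet.ncard) :
    (2 * (G.edgeSet.ncard : ℝ) / Fintype.card V - 1) ^ k ≤ (Fintype.card V : ℝ) / 2 := by
  classical
  induction hm : Fintype.card V generalizing V with
  | zero => omega
  | succ m ih =>
    have hcard : ∀ {W : Type u} (H : SimpleGraph W) [Fintype H.edgeSet],
        H.edgeSet.ncard = #H.edgeFinset := by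
      intro W H _
      rw [← coe_edgeFinset, Set.ncard_coe_finset]
    have : Nonempty V := Fintype.card_pos_iff.1 hV
    by_cases hdeg : ∀ v, 2 ≤ G.degree v
    · have := avg_degree_sub_one_pow_le_of_two_le_degree hbip hdeg k hk
      rwa [hm, ← hcard] at this
    · push Not at hdeg
      obtain ⟨v, hv⟩ := hdeg
      have hm' : Fintype.card ({v}ᶜ : Set V) = m := by
        rw [Fintype.card_compl_set, hm]
        simp
      have hE' : (G.induce {v}ᶜ).edgeSet.ncard + 1 ≥ G.edgeSet.ncard := by
        have h1 := G.card_edgeFinset_induce_compl_singleton v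
        rw [card_edgeFinset_deleteIncidenceSet] at h1
        rw [← hcard, ← hcard] at h1
        omega
      have hm0 : 0 < m := by
        by_contra! h0
        have h1 : Fintype.card V ≤ 1 := by omega
        have : Subsingleton V := Fintype.card_le_one_iff_subsingleton.1 h1
        have : G.edgeSet = ∅ := by
          rw [Subsingleton.elim G ⊥, edgeSet_bot]
        simp [this, hm] at hE
      have h := ih (G := G.induce {v}ᶜ) (hbip.of_hom (Embedding.induce _).toHom)
        (hk.trans_le (G.egirth_le_egirth_induce _)) (by omega) (by omega) hm'
      have hmR : (0 : ℝ) < m := Nat.cast_pos.2 hm0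
      have hER : (m : ℝ) + 1 ≤ G.edgeSet.ncard := by exact_mod_cast hm ▸ hE
      have hER' : (G.edgeSet.ncard : ℝ) ≤ (G.induce {v}ᶜ).edgeSet.ncard + 1 := by
        exact_mod_cast hE'
      push_cast
      have hone : 1 ≤ 2 * (G.edgeSet.ncard : ℝ) / (m + 1) - 1 := by
        rw [le_sub_iff_add_le, le_div_iff₀ (by positivity)]
        linarith
      have havg : 2 * (G.edgeSet.ncard : ℝ) / (m + 1) ≤
          2 * ((G.induce {v}ᶜ).edgeSet.ncard : ℝ) / m := by
        rw [div_le_div_iff₀ (by positivity) hmR]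
        nlinarith
      refine (pow_le_pow_left₀ (by linarith) (sub_le_sub_right havg 1) k).trans (h.trans ?_)
      linarith

end SimpleGraph

/-- Moore-bound consequence: let `n ≥ 4` and let `G` be a bipartite graph with
average degree `d = 2|E(G)|/|V(G)| ≥ 2` and girth greater than `⌊n/2⌋`. Then
`d ≤ (|V(G)|/2)^(1/⌊n/4⌋) + 1`. -/
theorem bipartite_high_girth_avg_degree_bound
    {V : Type*} [Fintype V] (G : SimpleGraph V) (n : ℕ) (hn : 4 ≤ n)
    (hbip : G.Colorable 2) (d : ℝ)
    (hd : d = 2 * (G.edgeSet.ncard : ℝ) / (Fintype.card V : ℝ))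
    (hd2 : (2 : ℝ) ≤ d)
    (hg : ((n / 2 : ℕ) : ℕ∞) < G.egirth) :
    d ≤ ((Fintype.card V : ℝ) / 2) ^ ((1 : ℝ) / ((n / 4 : ℕ) : ℝ)) + 1 := by
  have hV : 0 < Fintype.card V := by
    rw [Nat.pos_iff_ne_zero]
    intro h
    rw [h, Nat.cast_zero, div_zero] at hd
    linarith
  have hN : (0 : ℝ) < Fintype.card V := Nat.cast_pos.2 hV
  have hE : Fintype.card V ≤ G.edgeSet.ncard := by
    rw [hd, le_div_iff₀ hN] at hd2
    exact_mod_cast (mul_le_mul_iff_right₀ (two_pos : (0 : ℝ) < 2)).1 hd2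
  have hk : ((2 * (n / 4) : ℕ) : ℕ∞) < G.egirth :=
    lt_of_le_of_lt (Nat.cast_le.2 (by omega)) hg
  have h := SimpleGraph.avg_degree_sub_one_pow_le hbip (n / 4) hk hV hE
  rw [← hd] at h
  have hk0 : n / 4 ≠ 0 := by omega
  have hroot := Real.rpow_le_rpow (pow_nonneg (by linarith) _) h
    (one_div_nonneg.2 (Nat.cast_nonneg (n / 4)))
  rw [one_div, Real.pow_rpow_inv_natCast (by linarith) hk0] at hroot
  rw [one_div]
  linarith
end

section
/- If an (m,s,3)-graph G is admissible for sets of size at most n, then the associated three-probe query scheme 𝒯_G is satisfiable for every set S ⊆ [m] of size at most n. -/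
/-- Binary strings of length at most `2` (the index `i : Fin 3` is the length). -/
def BStr3 : Type := Σ i : Fin 3, (Fin i.val → Bool)

/-- An `(m,s,3)`-graph: a bipartite graph with vertex sets `U = [m]` and
`V = BStr3 × Fin s` (the part `A_σ` for a binary string `σ` of length at most `2`
is `{σ} × Fin s`), where between each `u ∈ U` and each `A_σ` there is exactly one
edge, namely the one joining `u` to `(σ, nbr σ u)`. -/
structure ThreeGraph (m s : ℕ) where
  nbr : BStr3 → Fin m → Fin s

/-- The neighborhood `Γ_G(R)` of a set `R ⊆ [m]` in the whole graph `G`. -/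
def ThreeGraph.Gamma {m s : ℕ} (G : ThreeGraph m s) (R : Set (Fin m)) :
    Set (BStr3 × Fin s) :=
  {p | ∃ y ∈ R, G.nbr p.1 y = p.2}

/-- The neighborhood `Γ_{G₃}(R)` in the subgraph `G₃` induced by `U` and `V₃`
(the parts `A_σ` with `|σ| = 2`). -/
def ThreeGraph.Gamma3 {m s : ℕ} (G : ThreeGraph m s) (R : Set (Fin m)) :
    Set (BStr3 × Fin s) :=
  {p | p.1.1.val = 2 ∧ ∃ y ∈ R, G.nbr p.1 y = p.2}

/-- The neighborhood `Γ_{G₁∪G₂}(R)` in the union of the subgraphs `G₁` and `G₂`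
(the parts `A_σ` with `|σ| ≤ 1`). -/
def ThreeGraph.Gamma12 {m s : ℕ} (G : ThreeGraph m s) (R : Set (Fin m)) :
    Set (BStr3 × Fin s) :=
  {p | p.1.1.val ≤ 1 ∧ ∃ y ∈ R, G.nbr p.1 y = p.2}

/-- An `(m,s,3)`-graph `G` is admissible for sets of size at most `n` if:
(P1) every `R ⊆ [m]` with `|R| ≤ n + ⌈n·log₂(2m/n)⌉` satisfies `|Γ_G(R)| ≥ 5|R|`;
(P2) for every `S ⊆ [m]` with `|S| ≤ n` and every `R ⊆ [m]∖S` with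
`|R| > ⌈n·log₂(2m/n)⌉` there is `y ∈ R` with either `Γ_{G₃}(y) ∩ Γ_{G₃}(S) = ∅`,
or both `|Γ_{G₃}(y) ∩ Γ_{G₃}(S)| = 1` and
`|Γ_{G₁∪G₂}(y) ∩ Γ_{G₁∪G₂}((R∪S)∖{y})| ≤ 1`. -/
def ThreeGraph.Admissible {m s : ℕ} (G : ThreeGraph m s) (n : ℕ) : Prop :=
  (∀ R : Finset (Fin m),
      R.card ≤ n + ⌈(n : ℝ) * Real.logb 2 (2 * (m : ℝ) / (n : ℝ))⌉₊ →
      5 * R.card ≤ (G.Gamma ↑R).ncard) ∧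
  (∀ S R : Finset (Fin m), S.card ≤ n → Disjoint R S →
      ⌈(n : ℝ) * Real.logb 2 (2 * (m : ℝ) / (n : ℝ))⌉₊ < R.card →
      ∃ y ∈ R,
        (G.Gamma3 {y} ∩ G.Gamma3 ↑S = ∅) ∨
        ((G.Gamma3 {y} ∩ G.Gamma3 ↑S).ncard = 1 ∧
         (G.Gamma12 {y} ∩ G.Gamma12 ((↑R ∪ ↑S : Set (Fin m)) \ {y})).ncard ≤ 1))

/-- The answer of the systematic three-probe query scheme `𝒯_G` on memory `L`
for query `x`: the first probe is at the neighbor of `x` in `A_ε`; if the bits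
read so far are `σ`, the next probe is at the neighbor of `x` in `A_σ`; the
answer is the last bit read. -/
def ThreeGraph.answer {m s : ℕ} (G : ThreeGraph m s) (L : BStr3 × Fin s → Bool)
    (x : Fin m) : Bool :=
  let σ0 : BStr3 := ⟨⟨0, by omega⟩, ![]⟩
  let b1 := L (σ0, G.nbr σ0 x)
  let σ1 : BStr3 := ⟨⟨1, by omega⟩, ![b1]⟩
  let b2 := L (σ1, G.nbr σ1 x)
  let σ2 : BStr3 := ⟨⟨2, by omega⟩, ![b1, b2]⟩
  L (σ2, G.nbr σ2 x)

/-- `𝒯_G` is satisfiable for `S` if some memory assignment answers every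
membership query "Is `x` in `S`?" correctly. -/
def ThreeGraph.Satisfiable {m s : ℕ} (G : ThreeGraph m s) (S : Finset (Fin m)) : Prop :=
  ∃ L : BStr3 × Fin s → Bool, ∀ x : Fin m, (G.answer L x = true ↔ x ∈ S)

instance : DecidableEq BStr3 :=
  inferInstanceAs (DecidableEq (Σ i : Fin 3, (Fin i.val → Bool)))

namespace BStr3

/-- The empty string. -/
def root : BStr3 := ⟨⟨0, by omega⟩, ![]⟩

/-- The string consisting of one bit. -/
def mid (a : Bool) : BStr3 := ⟨⟨1, by omega⟩, ![a]⟩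

/-- The string consisting of two bits. -/
def leaf (a b : Bool) : BStr3 := ⟨⟨2, by omega⟩, ![a, b]⟩

theorem leaf_inj {a b c d : Bool} : leaf a b = leaf c d ↔ a = c ∧ b = d := by
  revert a b c d; decide

theorem root_ne_mid (a : Bool) : root ≠ mid a := by
  revert a; decide

theorem eq_root_or_mid_or_leaf (σ : BStr3) :
    σ = root ∨ (∃ a, σ = mid a) ∨ ∃ a b, σ = leaf a b := by
  obtain ⟨⟨i, hi⟩, f⟩ := σ
  interval_cases i
  · exact Or.inl (congrArg (Sigma.mk _) (Subsingleton.elim f ![]))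
  · refine Or.inr (Or.inl ⟨f 0, congrArg (Sigma.mk _) (funext fun j => ?_)⟩)
    rw [Subsingleton.elim j 0]
    rfl
  · refine Or.inr (Or.inr ⟨f 0, f 1, congrArg (Sigma.mk _) (funext fun j => ?_)⟩)
    revert j
    exact Fin.forall_fin_two.2 ⟨rfl, rfl⟩

theorem exists_eq_leaf (σ : BStr3) (hσ : σ.1.val = 2) : ∃ a b, σ = leaf a b := by
  rcases eq_root_or_mid_or_leaf σ with rfl | ⟨a, rfl⟩ | h
  · exact absurd hσ (by decide)
  · exact absurd (show 1 = 2 from hσ) (by decide)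
  · exact h

instance : Fintype BStr3 where
  elems := {root, mid false, mid true, leaf false false, leaf false true, leaf true false,
    leaf true true}
  complete σ := by
    rcases eq_root_or_mid_or_leaf σ with rfl | ⟨a, rfl⟩ | ⟨a, b, rfl⟩
    · simp
    · cases a <;> simp
    · cases a <;> cases b <;> simp

theorem univ_eq : (Finset.univ : Finset BStr3) =
    {root, mid false, mid true, leaf false false, leaf false true, leaf true false,
      leaf true true} := rfl

theorem card_eq_sum (O : Finset BStr3) :
    O.card = (if root ∈ O then 1 else 0) + ((if mid false ∈ O then 1 else 0) +
      ((if mid true ∈ O then 1 else 0) + ((if leaf false false ∈ O then 1 else 0) +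
      ((if leaf false true ∈ O then 1 else 0) + ((if leaf true false ∈ O then 1 else 0) +
      (if leaf true true ∈ O then 1 else 0)))))) := by
  have h : O.card = ∑ σ : BStr3, if σ ∈ O then 1 else 0 := by simp
  rw [h, univ_eq]
  repeat rw [Finset.sum_insert (by decide)]
  rw [Finset.sum_singleton]

/-- The leaf reached by descending from the root along the bits of `q`. -/
def reached (q : BStr3 → Bool) : BStr3 := leaf (q root) (q (mid (q root)))

/-- Controlling the bits at five of the seven nodes suffices to force the search into a
controlled leaf. -/
theorem exists_steering (O : Finset BStr3) (hO : 5 ≤ O.card) (v : Bool) :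
    ∃ p : BStr3 → Bool, (∀ a b, p (leaf a b) = v) ∧
      ∀ q : BStr3 → Bool, (∀ σ ∈ O, q σ = p σ) → q (reached q) = v := by
  classical
  let good (a : Bool) : Prop := (leaf a false ∈ O ∧ leaf a true ∈ O) ∨
    (mid a ∈ O ∧ (leaf a false ∈ O ∨ leaf a true ∈ O))
  let p : BStr3 → Bool := fun σ =>
    if σ = root then decide (¬ good false)
    else if σ = mid false then decide (leaf false false ∉ O)
    else if σ = mid true then decide (leaf true false ∉ O)
    else v
  have hroot : p root = decide (¬ good false) := if_pos rfl
  have hmid : ∀ a, p (mid a) = decide (leaf a false ∉ O) := by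
    intro a; cases a <;> rfl
  have hleaf : ∀ a b, p (leaf a b) = v := by
    intro a b; cases a <;> cases b <;> rfl
  refine ⟨p, hleaf, fun q hq => ?_⟩
  have hgood : (root ∈ O ∧ (good false ∨ good true)) ∨ (good false ∧ good true) := by
    rw [card_eq_sum] at hO
    simp only [good]
    split_ifs at hO <;> simp_all
  have key : good (q root) := by
    rcases hgood with ⟨hr, h⟩ | ⟨h0, h1⟩
    · rw [hq _ hr, hroot]
      by_cases h0 : good false
      · simp [h0]
      · simpa [h0] using h.resolve_left h0
    · cases q root <;> assumption
  unfold reached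
  generalize q root = a at key
  suffices h : leaf a (q (mid a)) ∈ O by rw [hq _ h, hleaf]
  rcases key with ⟨h0, h1⟩ | ⟨hm, h⟩
  · cases q (mid a) <;> assumption
  · rw [hq _ hm, hmid]
    by_cases h0 : leaf a false ∈ O
    · simp [h0]
    · simpa [h0] using h.resolve_left h0

end BStr3

namespace ThreeGraph

open BStr3

variable {m s : ℕ} (G : ThreeGraph m s)

/-- The bits stored at the neighbors of `x`. -/
def view (L : BStr3 × Fin s → Bool) (x : Fin m) (σ : BStr3) : Bool := L (σ, G.nbr σ x)

theorem answer_eq (L : BStr3 × Fin s → Bool) (x : Fin m) :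
    G.answer L x = G.view L x (reached (G.view L x)) := rfl

/-- Hall's theorem: if all subsets of `T` expand by a factor of five, then each vertex of `T`
owns five of its neighbors, with no neighbor owned twice. -/
theorem exists_owned (T : Finset (Fin m))
    (hT : ∀ R ⊆ T, 5 * R.card ≤ (G.Gamma ↑R).ncard) :
    ∃ O : Fin m → Finset BStr3, (∀ x ∈ T, 5 ≤ (O x).card) ∧
      ∀ x ∈ T, ∀ y ∈ T, ∀ σ, σ ∈ O x → σ ∈ O y → G.nbr σ x = G.nbr σ y → x = y := by
  classical
  let t : T × Fin 5 → Finset (BStr3 × Fin s) := fun z =>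
    Finset.univ.image fun σ => (σ, G.nbr σ z.1)
  have hall : ∀ A : Finset (T × Fin 5), A.card ≤ (A.biUnion t).card := by
    intro A
    let B : Finset T := A.image Prod.fst
    have h1 : A.card ≤ 5 * B.card := by
      have hsub : A ⊆ B ×ˢ (Finset.univ : Finset (Fin 5)) := by
        intro z hz
        simp only [Finset.mem_product, Finset.mem_univ, and_true]
        exact Finset.mem_image_of_mem _ hz
      have := Finset.card_le_card hsub
      rw [Finset.card_product, Finset.card_fin] at this
      omega
    have h2 := hT (B.map (Function.Embedding.subtype _)) (by
      intro x hx
      obtain ⟨z, -, rfl⟩ := Finset.mem_map.1 hx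
      exact z.2)
    rw [Finset.card_map] at h2
    have h3 : G.Gamma ↑(B.map (Function.Embedding.subtype _)) = ↑(A.biUnion t) := by
      ext ⟨σ, j⟩
      simp only [Gamma, t, B, Set.mem_ofPred_eq, Finset.mem_coe, Finset.mem_map,
        Finset.mem_image, Finset.mem_biUnion, Finset.mem_univ, true_and, Prod.mk.injEq]
      constructor
      · rintro ⟨_, ⟨_, ⟨z, hz, rfl⟩, rfl⟩, h⟩
        exact ⟨z, hz, σ, rfl, h⟩
      · rintro ⟨z, hz, _, rfl, h⟩
        exact ⟨z.1, ⟨z.1, ⟨z, hz, rfl⟩, rfl⟩, h⟩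
    rw [h3, Set.ncard_coe_finset] at h2
    exact h1.trans h2
  obtain ⟨f, hf, hft⟩ := (Finset.all_card_le_biUnion_card_iff_exists_injective t).1 hall
  have hfst : ∀ z, f z = ((f z).1, G.nbr (f z).1 z.1) := by
    intro z
    obtain ⟨σ, -, h⟩ := Finset.mem_image.1 (hft z)
    rw [← h]
  refine ⟨fun x => if hx : x ∈ T then Finset.univ.image fun i => (f (⟨x, hx⟩, i)).1 else ∅,
    fun x hx => ?_, fun x hx y hy σ h1 h2 h => ?_⟩
  · simp only [hx, dif_pos]
    rw [Finset.card_image_of_injective, Finset.card_fin]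
    intro i j hij
    have := hf (a₁ := (⟨x, hx⟩, i)) (a₂ := (⟨x, hx⟩, j)) (by
      rw [hfst (⟨x, hx⟩, i), hfst (⟨x, hx⟩, j)]
      simp only at hij ⊢
      rw [hij])
    exact (Prod.mk.inj this).2
  · simp only [hx, hy, dif_pos, Finset.mem_image, Finset.mem_univ, true_and] at h1 h2
    obtain ⟨i, hi⟩ := h1
    obtain ⟨j, hj⟩ := h2
    have := hf (a₁ := (⟨x, hx⟩, i)) (a₂ := (⟨y, hy⟩, j)) (by
      rw [hfst (⟨x, hx⟩, i), hfst (⟨y, hy⟩, j), hi, hj]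
      simp only
      rw [h])
    exact congrArg Subtype.val (Prod.mk.inj this).1

/-- `L` answers correctly on `R ∪ S`, and vanishes at all leaves that are not adjacent
to `S`. -/
def Serves (S R : Finset (Fin m)) (L : BStr3 × Fin s → Bool) : Prop :=
  (∀ p : BStr3 × Fin s, p.1.1.val = 2 → p ∉ G.Gamma3 ↑S → L p = false) ∧
    ∀ x, x ∈ R ∨ x ∈ S → (G.answer L x = true ↔ x ∈ S)

variable {G}

theorem exists_serves_of_expansion {S R : Finset (Fin m)}
    (h : ∀ Q ⊆ R ∪ S, 5 * Q.card ≤ (G.Gamma ↑Q).ncard) : ∃ L, G.Serves S R L := by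
  classical
  obtain ⟨O, hO, hdisj⟩ := G.exists_owned _ h
  have hst : ∀ x, ∃ p : BStr3 → Bool, (∀ a b, p (leaf a b) = decide (x ∈ S)) ∧
      (x ∈ R ∪ S → ∀ q : BStr3 → Bool, (∀ σ ∈ O x, q σ = p σ) →
        q (reached q) = decide (x ∈ S)) := by
    intro x
    by_cases hx : x ∈ R ∪ S
    · obtain ⟨p, h1, h2⟩ := exists_steering (O x) (hO x hx) (decide (x ∈ S))
      exact ⟨p, h1, fun _ => h2⟩
    · exact ⟨fun _ => decide (x ∈ S), fun _ _ => rfl, fun h => absurd h hx⟩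
  choose p hpleaf hp using hst
  let L : BStr3 × Fin s → Bool := fun z =>
    if hz : ∃ x ∈ R ∪ S, z.1 ∈ O x ∧ G.nbr z.1 x = z.2 then p hz.choose z.1 else false
  refine ⟨L, ?_, fun x hx => ?_⟩
  · rintro ⟨σ, j⟩ hz2 hzS
    obtain ⟨a, b, rfl⟩ := exists_eq_leaf σ hz2
    by_cases hz : ∃ x ∈ R ∪ S, leaf a b ∈ O x ∧ G.nbr (leaf a b) x = j
    · simp only [L, dif_pos hz]
      rw [hpleaf, decide_eq_false_iff_not]
      exact fun hS => hzS ⟨hz2, _, hS, hz.choose_spec.2.2⟩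
    · simp only [L, dif_neg hz]
  · have hxT : x ∈ R ∪ S := Finset.mem_union.2 hx
    rw [answer_eq, hp x hxT (G.view L x), decide_eq_true_iff]
    intro σ hσ
    have hz : ∃ y ∈ R ∪ S, σ ∈ O y ∧ G.nbr σ y = G.nbr σ x := ⟨x, hxT, hσ, rfl⟩
    have hy := hz.choose_spec
    have : hz.choose = x := hdisj _ hy.1 x hxT σ hy.2.1 hσ hy.2.2
    simp only [view, L, dif_pos hz, this]

/-- Rewriting a non-leaf cell of `y` that no other vertex of `R ∪ S` is adjacent to. -/
theorem Serves.update {S R : Finset (Fin m)} {L : BStr3 × Fin s → Bool} {y : Fin m}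
    (hL : G.Serves S (R.erase y) L) {σ : BStr3} (hσ : σ.1.val ≤ 1) (c : Bool)
    (hfree : (σ, G.nbr σ y) ∉ G.Gamma12 ((↑R ∪ ↑S : Set (Fin m)) \ {y})) (hyS : y ∉ S)
    (hy : G.answer (Function.update L (σ, G.nbr σ y) c) y = false) :
    G.Serves S R (Function.update L (σ, G.nbr σ y) c) := by
  refine ⟨fun p hp hpS => ?_, fun x hx => ?_⟩
  · rw [Function.update_of_ne, hL.1 p hp hpS]
    rintro rfl
    simp only at hp
    omega
  · by_cases hxy : x = y
    · subst hxy
      simp [hy, hyS]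
    · rw [← hL.2 x (hx.imp_left fun h => Finset.mem_erase.2 ⟨hxy, h⟩)]
      have : G.view (Function.update L (σ, G.nbr σ y) c) x = G.view L x := by
        funext τ
        simp only [view]
        rw [Function.update_of_ne]
        intro h
        obtain ⟨rfl, h⟩ := Prod.mk.inj h
        exact hfree ⟨hσ, x, ⟨hx, hxy⟩, h⟩
      rw [answer_eq, answer_eq, this]

theorem Serves.exists_of_erase {S R : Finset (Fin m)} {L : BStr3 × Fin s → Bool} {y : Fin m}
    (hL : G.Serves S (R.erase y) L) (hyS : y ∉ S)
    (hy : (G.Gamma3 {y} ∩ G.Gamma3 ↑S = ∅) ∨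
        ((G.Gamma3 {y} ∩ G.Gamma3 ↑S).ncard = 1 ∧
         (G.Gamma12 {y} ∩ G.Gamma12 ((↑R ∪ ↑S : Set (Fin m)) \ {y})).ncard ≤ 1)) :
    ∃ L', G.Serves S R L' := by
  have hmem : ∀ a b, (leaf a b, G.nbr (leaf a b) y) ∈ G.Gamma3 {y} :=
    fun a b => ⟨rfl, y, rfl, rfl⟩
  rcases hy with hy | ⟨h3, h12⟩
  · refine ⟨L, hL.1, fun x hx => ?_⟩
    by_cases hxy : x = y
    · subst hxy
      have : G.answer L x = false := by
        rw [answer_eq]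
        refine hL.1 _ rfl fun h => ?_
        exact (Set.eq_empty_iff_forall_notMem.1 hy) _ ⟨hmem _ _, h⟩
      simp [this, hyS]
    · exact hL.2 x (hx.imp_left fun h => Finset.mem_erase.2 ⟨hxy, h⟩)
  · obtain ⟨⟨τ, j⟩, hz⟩ := Set.ncard_eq_one.1 h3
    have hτ : (τ, j) ∈ G.Gamma3 {y} ∩ G.Gamma3 ↑S := hz ▸ rfl
    obtain ⟨a, b, rfl⟩ := exists_eq_leaf τ hτ.1.1
    have avoid : ∀ (σ : BStr3) (c : Bool), σ.1.val ≤ 1 →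
        reached (G.view (Function.update L (σ, G.nbr σ y) c) y) ≠ leaf a b →
        G.answer (Function.update L (σ, G.nbr σ y) c) y = false := by
      intro σ c hσ hne
      rw [answer_eq]
      generalize hr : reached (G.view (Function.update L (σ, G.nbr σ y) c) y) = r at hne
      have hr2 : r.1.val = 2 := by rw [← hr]; rfl
      rw [view, Function.update_of_ne]
      · refine hL.1 _ hr2 fun h => hne ?_
        have : (r, G.nbr r y) ∈ ({(leaf a b, j)} : Set (BStr3 × Fin s)) :=
          hz ▸ ⟨⟨hr2, y, rfl, rfl⟩, h⟩
        exact congrArg Prod.fst this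
      · intro h
        have := congrArg (fun z => z.1.1.val) h
        simp only at this
        omega
    by_cases hroot : (root, G.nbr root y) ∈ G.Gamma12 ((↑R ∪ ↑S : Set (Fin m)) \ {y})
    · have hmid : (mid a, G.nbr (mid a) y) ∉ G.Gamma12 ((↑R ∪ ↑S : Set (Fin m)) \ {y}) := by
        intro hmid
        have := (Set.ncard_le_one (Set.toFinite _)).1 h12 _
          ⟨⟨Nat.zero_le _, y, rfl, rfl⟩, hroot⟩ _ ⟨⟨le_refl 1, y, rfl, rfl⟩, hmid⟩
        exact root_ne_mid a (congrArg Prod.fst this)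
      refine ⟨_, hL.update (le_refl 1) (!b) hmid hyS (avoid _ _ (le_refl 1) ?_)⟩
      intro h
      obtain ⟨h1, h2⟩ := leaf_inj.1 h
      rw [h1] at h2
      simp [view] at h2
    · refine ⟨_, hL.update (Nat.zero_le 1) (!a) hroot hyS (avoid _ _ (Nat.zero_le 1) ?_)⟩
      intro h
      have h1 := (leaf_inj.1 h).1
      simp [view] at h1

theorem Admissible.exists_serves {n : ℕ} (hG : G.Admissible n) {S : Finset (Fin m)}
    (hS : S.card ≤ n) (R : Finset (Fin m)) (hR : Disjoint R S) : ∃ L, G.Serves S R L := by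
  induction R using Finset.strongInduction with
  | H R ih =>
    by_cases hc : ⌈(n : ℝ) * Real.logb 2 (2 * (m : ℝ) / (n : ℝ))⌉₊ < R.card
    · obtain ⟨y, hyR, hy⟩ := hG.2 S R hS hR hc
      obtain ⟨L, hL⟩ := ih _ (Finset.erase_ssubset hyR)
        (hR.mono_left (Finset.erase_subset _ _))
      exact hL.exists_of_erase (Finset.disjoint_left.1 hR hyR) hy
    · refine exists_serves_of_expansion fun Q hQ => hG.1 Q ?_
      have h1 := Finset.card_le_card hQ
      have h2 := Finset.card_union_le R S
      omega

end ThreeGraph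

/-- If an `(m,s,3)`-graph `G` is admissible for sets of size at most `n`, then
the associated three-probe query scheme `𝒯_G` is satisfiable for every set
`S ⊆ [m]` of size at most `n`. -/
theorem admissible_implies_satisfiable {m s n : ℕ} (G : ThreeGraph m s)
    (hG : G.Admissible n) :
    ∀ S : Finset (Fin m), S.card ≤ n → G.Satisfiable S := by
  intro S hS
  obtain ⟨L, hL⟩ := hG.exists_serves hS Sᶜ disjoint_compl_left
  exact ⟨L, fun x => hL.2 x (by simp [em'])⟩
end

section
/- For all sufficiently large m and all integers n with 1 ≤ n ≤ m, there exists an (m,s,3)-graph with s = ⌈500·√(m·n·log₂(2m/n))⌉ that is admissible for sets of size at most n. -/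
open Finset in
/-- A function that satisfies `f c = f (p c)` for all `c ∈ T`, where `p` decreases a rank, is
determined by its values off `T`. -/
lemma card_forall_eq_mul_pow_le {I : Type*} [Fintype I] [DecidableEq I] (s : ℕ) (rank : I → ℕ)
    (T : Finset I) (p : I → I) (hp : ∀ c ∈ T, rank (p c) < rank c) :
    #{f : I → Fin s | ∀ c ∈ T, f c = f (p c)} * s ^ #T ≤ s ^ Fintype.card I := by
  have hcard : #{f : I → Fin s | ∀ c ∈ T, f c = f (p c)} ≤
      #(univ : Finset ({c // c ∉ T} → Fin s)) := by
    refine card_le_card_of_injOn (fun f c => f c.1) (fun _ _ => by simp) ?_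
    intro f hf g hg hfg
    simp only [coe_filter, mem_univ, true_and, Set.mem_ofPred_eq] at hf hg
    have key : ∀ k c, rank c = k → f c = g c := by
      intro k
      induction k using Nat.strong_induction_on with
      | _ k ih =>
        intro c hc
        by_cases hT : c ∈ T
        · rw [hf c hT, hg c hT]
          exact ih _ (hc ▸ hp c hT) _ rfl
        · exact congrFun hfg ⟨c, hT⟩
    exact funext fun c => key _ c rfl
  have hcompl : Fintype.card {c // c ∉ T} = Fintype.card I - #T := by
    simp
  rw [card_univ, Fintype.card_fun, Fintype.card_fin, hcompl] at hcard
  calc _ ≤ s ^ (Fintype.card I - #T) * s ^ #T := Nat.mul_le_mul_right _ hcard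
    _ = s ^ Fintype.card I := by rw [← pow_add, Nat.sub_add_cancel (card_le_univ T)]

open Finset in
lemma card_forall_exists_eq_mul_pow_le {I : Type*} [Fintype I] [DecidableEq I] (s : ℕ)
    (rank : I → ℕ) (T : Finset I) (P : I → Finset I)
    (hP : ∀ c ∈ T, ∀ c' ∈ P c, rank c' < rank c) :
    #{f : I → Fin s | ∀ c ∈ T, ∃ c' ∈ P c, f c = f c'} * s ^ #T ≤
      (∏ c ∈ T, #(P c)) * s ^ Fintype.card I := by
  let extend (p : (c : I) → c ∈ T → I) (c : I) : I := if h : c ∈ T then p c h else c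
  have hsub : ({f : I → Fin s | ∀ c ∈ T, ∃ c' ∈ P c, f c = f c'} : Finset _) ⊆
      (T.pi P).biUnion fun p => {f : I → Fin s | ∀ c ∈ T, f c = f (extend p c)} := by
    intro f hf
    simp only [mem_filter, mem_univ, true_and] at hf
    choose! p hpP hpf using hf
    simp only [mem_biUnion, mem_pi, mem_filter, mem_univ, true_and]
    refine ⟨fun c _ => p c, fun c hc => hpP c hc, fun c hc => ?_⟩
    simp [extend, hc, hpf c hc]
  calc _ ≤ (∑ p ∈ T.pi P, #{f : I → Fin s | ∀ c ∈ T, f c = f (extend p c)}) * s ^ #T :=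
        Nat.mul_le_mul_right _ ((card_le_card hsub).trans card_biUnion_le)
    _ = ∑ p ∈ T.pi P, #{f : I → Fin s | ∀ c ∈ T, f c = f (extend p c)} * s ^ #T := sum_mul ..
    _ ≤ ∑ _p ∈ T.pi P, s ^ Fintype.card I := by
        refine sum_le_sum fun p hp => card_forall_eq_mul_pow_le s rank T _ fun c hc => ?_
        simpa [extend, hc] using hP c hc _ (mem_pi.1 hp c hc)
    _ = _ := by rw [sum_const, card_pi, smul_eq_mul]

open Finset in
/-- Union bound over the set `T ⊆ C` of `k` cells whose value repeats that of a predecessor. -/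
lemma card_exists_repeats_mul_pow_le {I : Type*} [Fintype I] [DecidableEq I] (s k K : ℕ)
    (rank : I → ℕ) (C : Finset I) (P : I → Finset I)
    (hP : ∀ c ∈ C, ∀ c' ∈ P c, rank c' < rank c) (B : Finset (I → Fin s))
    (hB : ∀ f ∈ B, ∃ T ⊆ C, #T = k ∧ ∏ c ∈ T, #(P c) ≤ K ∧ ∀ c ∈ T, ∃ c' ∈ P c, f c = f c') :
    #B * s ^ k ≤ 2 ^ #C * K * s ^ Fintype.card I := by
  let 𝒯 : Finset (Finset I) := {T ∈ C.powerset | #T = k ∧ ∏ c ∈ T, #(P c) ≤ K}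
  have hsub : B ⊆ 𝒯.biUnion fun T => {f : I → Fin s | ∀ c ∈ T, ∃ c' ∈ P c, f c = f c'} := by
    intro f hf
    obtain ⟨T, hTC, hTk, hTK, hT⟩ := hB f hf
    simp only [mem_biUnion, mem_filter, mem_univ, true_and, mem_powerset, 𝒯]
    exact ⟨T, ⟨hTC, hTk, hTK⟩, hT⟩
  calc #B * s ^ k
      ≤ (∑ T ∈ 𝒯, #{f : I → Fin s | ∀ c ∈ T, ∃ c' ∈ P c, f c = f c'}) * s ^ k :=
        Nat.mul_le_mul_right _ ((card_le_card hsub).trans card_biUnion_le)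
    _ = ∑ T ∈ 𝒯, #{f : I → Fin s | ∀ c ∈ T, ∃ c' ∈ P c, f c = f c'} * s ^ k := sum_mul ..
    _ ≤ ∑ _T ∈ 𝒯, K * s ^ Fintype.card I := by
        refine sum_le_sum fun T hT => ?_
        simp only [mem_filter, mem_powerset, 𝒯] at hT
        rw [← hT.2.1]
        exact (card_forall_exists_eq_mul_pow_le s rank T P fun c hc => hP c (hT.1 hc)).trans
          (Nat.mul_le_mul_right _ hT.2.2)
    _ = #𝒯 * (K * s ^ Fintype.card I) := by rw [sum_const, smul_eq_mul]
    _ ≤ 2 ^ #C * (K * s ^ Fintype.card I) := by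
        refine Nat.mul_le_mul_right _ ?_
        rw [← card_powerset]
        exact card_filter_le _ _
    _ = _ := by ring

open Finset in
/-- At most half of the elements that share their `g`-value come first in their class. -/
lemma card_shared_le_two_mul_card_repeat {α β : Type*} [LinearOrder α] [DecidableEq β]
    (W : Finset α) (g : α → β) :
    #{y ∈ W | ∃ x ∈ W, x ≠ y ∧ g x = g y} ≤ 2 * #{y ∈ W | ∃ x ∈ W, x < y ∧ g x = g y} := by
  set A := {y ∈ W | ∃ x ∈ W, x ≠ y ∧ g x = g y} with hA
  set B := {y ∈ W | ∃ x ∈ W, x < y ∧ g x = g y} with hB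
  have h1 : #(A \ B) ≤ #B := by
    have hex : ∀ y ∈ A \ B, ∃ x ∈ W, y < x ∧ g x = g y := by
      intro y hy
      simp only [hA, hB, mem_sdiff, mem_filter, not_and, not_exists] at hy
      obtain ⟨⟨hyW, x, hxW, hne, hg⟩, hy2⟩ := hy
      exact ⟨x, hxW, lt_of_le_of_ne (not_lt.1 fun h => hy2 hyW x hxW h hg) hne.symm, hg⟩
    choose! φ hφW hφlt hφg using hex
    refine card_le_card_of_injOn φ ?_ ?_
    · intro y hy
      simp only [hB, coe_filter, Set.mem_ofPred_eq]
      refine ⟨hφW y hy, y, ?_, hφlt y hy, (hφg y hy).symm⟩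
      exact (mem_filter.1 (mem_sdiff.1 hy).1).1
    · intro y hy z hz hyz
      have hg : g y = g z := by rw [← hφg y hy, ← hφg z hz, hyz]
      have hyW := (mem_filter.1 (mem_sdiff.1 hy).1).1
      have hzW := (mem_filter.1 (mem_sdiff.1 hz).1).1
      rcases lt_trichotomy y z with h | h | h
      · exact absurd (mem_filter.2 ⟨hzW, y, hyW, h, hg⟩) (mem_sdiff.1 hz).2
      · exact h
      · exact absurd (mem_filter.2 ⟨hyW, z, hzW, h, hg.symm⟩) (mem_sdiff.1 hy).2
  have h2 := card_le_card_sdiff_add_card (s := A) (t := B)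
  omega

instance : Fintype BStr3 := inferInstanceAs (Fintype (Σ i : Fin 3, (Fin i.val → Bool)))

/-- The graph whose edge from `u` to `A_σ` ends in `f (σ, u)`. -/
def ThreeGraph.ofFun {m s : ℕ} (f : BStr3 × Fin m → Fin s) : ThreeGraph m s :=
  ⟨fun σ u => f (σ, u)⟩

lemma card_bStr3 : Fintype.card BStr3 = 7 := by decide

open Finset in
lemma card_bStr3_length_eq_two : #{σ : BStr3 | σ.1.val = 2} = 4 := by decide

open Finset in
lemma card_bStr3_length_le_one : #{σ : BStr3 | σ.1.val ≤ 1} = 3 := by decide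

open Finset in
open scoped Classical in
lemma card_small_neighborhood_mul_pow_le {m s : ℕ} (R : Finset (Fin m)) :
    #{f : BStr3 × Fin m → Fin s | ((ThreeGraph.ofFun f).Gamma ↑R).ncard < 5 * #R} *
        s ^ (2 * #R) ≤
      2 ^ (7 * #R) * #R ^ (2 * #R) * s ^ Fintype.card (BStr3 × Fin m) := by
  have hC : #((univ : Finset BStr3) ×ˢ R) = 7 * #R := by
    rw [card_product, card_univ, card_bStr3]
  rw [← hC]
  let P : BStr3 × Fin m → Finset (BStr3 × Fin m) := fun c => {c.1} ×ˢ {x ∈ R | x < c.2}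
  refine card_exists_repeats_mul_pow_le s _ _ (fun c => c.2.val) _ P ?_ _ ?_
  · rintro ⟨σ, y⟩ - ⟨τ, x⟩ h
    simp only [P, mem_product, mem_filter] at h
    exact h.2.2
  · intro f hf
    simp only [mem_filter, mem_univ, true_and] at hf
    set T : Finset (BStr3 × Fin m) := {c ∈ univ ×ˢ R | ∃ c' ∈ P c, f c = f c'} with hT
    have hinj : #((univ ×ˢ R) \ T) ≤ ((ThreeGraph.ofFun f).Gamma ↑R).ncard := by
      rw [← Set.ncard_coe_finset]
      refine Set.ncard_le_ncard_of_injOn (fun c => (c.1, f c)) ?_ ?_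
      · rintro ⟨σ, y⟩ h
        simp only [coe_sdiff, Set.mem_sdiff, mem_coe, mem_product] at h
        exact ⟨y, h.1.2, rfl⟩
      · rintro ⟨σ, y⟩ hy ⟨τ, z⟩ hz h
        simp only [Prod.mk.injEq] at h
        obtain ⟨rfl, h⟩ := h
        simp only [hT, coe_sdiff, Set.mem_sdiff, mem_coe, mem_product, mem_univ, true_and,
          mem_filter, P, mem_singleton, not_and, not_exists] at hy hz
        rcases lt_trichotomy y z with hlt | rfl | hlt
        · exact absurd h.symm (hz.2 hz.1 (σ, y) ⟨rfl, hy.1, hlt⟩)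
        · rfl
        · exact absurd h (hy.2 hy.1 (σ, z) ⟨rfl, hz.1, hlt⟩)
    have hcard := card_le_card_sdiff_add_card (s := univ ×ˢ R) (t := T)
    obtain ⟨T', hT'T, hT'⟩ := exists_subset_card_eq (s := T) (n := 2 * #R) (by omega)
    refine ⟨T', hT'T.trans (filter_subset _ _), hT', ?_, fun c hc => (mem_filter.1 (hT'T hc)).2⟩
    rw [← hT']
    refine prod_le_pow_card _ _ _ fun c _ => ?_
    simpa [P] using card_filter_le R _

open Finset in
lemma card_filter_product_eq_sum {α β : Type*} (A : Finset α) (B : Finset β)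
    (p : α × β → Prop) [DecidablePred p] :
    #{c ∈ A ×ˢ B | p c} = ∑ y ∈ B, #{x ∈ A | p (x, y)} := by
  simp only [card_filter, sum_product_right]

open Finset in
lemma card_filter_product_eq_sum_left {α β : Type*} (A : Finset α) (B : Finset β)
    (p : α × β → Prop) [DecidablePred p] :
    #{c ∈ A ×ˢ B | p c} = ∑ x ∈ A, #{y ∈ B | p (x, y)} := by
  simp only [card_filter, sum_product]

open Finset in
open scoped Classical in
lemma ncard_Gamma3_inter {m s : ℕ} (f : BStr3 × Fin m → Fin s) (S : Finset (Fin m))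
    (y : Fin m) :
    ((ThreeGraph.ofFun f).Gamma3 {y} ∩ (ThreeGraph.ofFun f).Gamma3 ↑S).ncard =
      #{σ ∈ {σ : BStr3 | σ.1.val = 2} | ∃ x ∈ S, f (σ, x) = f (σ, y)} := by
  have himage : (ThreeGraph.ofFun f).Gamma3 {y} ∩ (ThreeGraph.ofFun f).Gamma3 ↑S =
      (fun σ => (σ, f (σ, y))) ''
        ↑({σ ∈ {σ : BStr3 | σ.1.val = 2} | ∃ x ∈ S, f (σ, x) = f (σ, y)} : Finset BStr3) := by
    ext ⟨σ, v⟩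
    simp only [ThreeGraph.Gamma3, ThreeGraph.ofFun, Set.mem_inter_iff, Set.mem_ofPred_eq,
      Set.mem_singleton_iff, exists_eq_left, Set.mem_image, mem_coe, mem_filter, mem_univ,
      true_and, Prod.mk.injEq]
    constructor
    · rintro ⟨⟨hσ, rfl⟩, -, x, hx, h⟩
      exact ⟨σ, ⟨hσ, x, hx, h⟩, rfl, rfl⟩
    · rintro ⟨σ, ⟨hσ, x, hx, h⟩, rfl, rfl⟩
      exact ⟨⟨hσ, rfl⟩, hσ, x, hx, h⟩
  rw [himage, Set.ncard_image_of_injective _ fun σ τ h => (Prod.mk.inj h).1,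
    Set.ncard_coe_finset]

open Finset in
open scoped Classical in
lemma ncard_Gamma12_inter {m s : ℕ} (f : BStr3 × Fin m → Fin s) (W : Finset (Fin m))
    (y : Fin m) :
    ((ThreeGraph.ofFun f).Gamma12 {y} ∩ (ThreeGraph.ofFun f).Gamma12 (↑W \ {y})).ncard =
      #{σ ∈ {σ : BStr3 | σ.1.val ≤ 1} | ∃ x ∈ W, x ≠ y ∧ f (σ, x) = f (σ, y)} := by
  have himage : (ThreeGraph.ofFun f).Gamma12 {y} ∩ (ThreeGraph.ofFun f).Gamma12 (↑W \ {y}) =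
      (fun σ => (σ, f (σ, y))) '' ↑({σ ∈ {σ : BStr3 | σ.1.val ≤ 1} |
        ∃ x ∈ W, x ≠ y ∧ f (σ, x) = f (σ, y)} : Finset BStr3) := by
    ext ⟨σ, v⟩
    simp only [ThreeGraph.Gamma12, ThreeGraph.ofFun, Set.mem_inter_iff, Set.mem_ofPred_eq,
      Set.mem_singleton_iff, exists_eq_left, Set.mem_image, mem_coe, mem_filter, mem_univ,
      true_and, Prod.mk.injEq, Set.mem_sdiff]
    constructor
    · rintro ⟨⟨hσ, rfl⟩, -, x, ⟨hx, hne⟩, h⟩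
      exact ⟨σ, ⟨hσ, x, hx, hne, h⟩, rfl, rfl⟩
    · rintro ⟨σ, ⟨hσ, x, hx, hne, h⟩, rfl, rfl⟩
      exact ⟨⟨hσ, rfl⟩, hσ, x, ⟨hx, hne⟩, h⟩
  rw [himage, Set.ncard_image_of_injective _ fun σ τ h => (Prod.mk.inj h).1,
    Set.ncard_coe_finset]

/-- The element `y` satisfies the requirement of the second admissibility condition. -/
def ThreeGraph.Escapes {m s : ℕ} (G : ThreeGraph m s) (S R : Finset (Fin m)) (y : Fin m) :
    Prop :=
  (G.Gamma3 {y} ∩ G.Gamma3 ↑S = ∅) ∨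
    ((G.Gamma3 {y} ∩ G.Gamma3 ↑S).ncard = 1 ∧
      (G.Gamma12 {y} ∩ G.Gamma12 ((↑R ∪ ↑S : Set (Fin m)) \ {y})).ncard ≤ 1)

open Finset in
open scoped Classical in
/-- If no element of `R` escapes, then there are at least `|R|` cells of `G₃` meeting the
neighborhood of `S`, and together with the repeats in `G₁ ∪ G₂` at least `2|R|`. -/
lemma card_le_of_forall_not_escapes {m s : ℕ} (f : BStr3 × Fin m → Fin s)
    (S R : Finset (Fin m)) (h : ∀ y ∈ R, ¬ (ThreeGraph.ofFun f).Escapes S R y) :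
    #R ≤ #{c ∈ ({σ : BStr3 | σ.1.val = 2} : Finset BStr3) ×ˢ R |
        ∃ x ∈ S, f (c.1, x) = f c} ∧
    2 * #R ≤ #{c ∈ ({σ : BStr3 | σ.1.val = 2} : Finset BStr3) ×ˢ R |
        ∃ x ∈ S, f (c.1, x) = f c} +
      #{c ∈ ({σ : BStr3 | σ.1.val ≤ 1} : Finset BStr3) ×ˢ (R ∪ S) |
        ∃ x ∈ R ∪ S, x < c.2 ∧ f (c.1, x) = f c} := by
  let a (y : Fin m) : ℕ :=
    #{σ ∈ {σ : BStr3 | σ.1.val = 2} | ∃ x ∈ S, f (σ, x) = f (σ, y)}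
  let b (y : Fin m) : ℕ :=
    #{σ ∈ {σ : BStr3 | σ.1.val ≤ 1} | ∃ x ∈ R ∪ S, x ≠ y ∧ f (σ, x) = f (σ, y)}
  have hab : ∀ y ∈ R, 1 ≤ a y ∧ (a y = 1 → 2 ≤ b y) := by
    intro y hy
    have hy := h y hy
    rw [ThreeGraph.Escapes, ← Set.ncard_eq_zero (Set.toFinite _), ncard_Gamma3_inter,
      ← coe_union, ncard_Gamma12_inter] at hy
    change ¬ (a y = 0 ∨ a y = 1 ∧ b y ≤ 1) at hy
    omega
  rw [card_filter_product_eq_sum]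
  change _ ≤ ∑ y ∈ R, a y ∧ _ ≤ ∑ y ∈ R, a y + _
  have hb : ∑ y ∈ R, b y ≤ 2 * #{c ∈ ({σ : BStr3 | σ.1.val ≤ 1} : Finset BStr3) ×ˢ (R ∪ S) |
        ∃ x ∈ R ∪ S, x < c.2 ∧ f (c.1, x) = f c} := by
    calc ∑ y ∈ R, b y ≤ ∑ y ∈ R ∪ S, b y := sum_le_sum_of_subset subset_union_left
      _ = #{c ∈ ({σ : BStr3 | σ.1.val ≤ 1} : Finset BStr3) ×ˢ (R ∪ S) |
            ∃ x ∈ R ∪ S, x ≠ c.2 ∧ f (c.1, x) = f c} := by rw [card_filter_product_eq_sum]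
      _ ≤ _ := by
        rw [card_filter_product_eq_sum_left, card_filter_product_eq_sum_left, mul_sum]
        refine sum_le_sum fun σ _ => ?_
        convert card_shared_le_two_mul_card_repeat (R ∪ S) fun x => f (σ, x)
        rfl
  constructor
  · simpa using sum_le_sum fun y hy => (hab y hy).1
  · have : ∑ y ∈ R, 4 ≤ ∑ y ∈ R, (2 * a y + b y) := by
      refine sum_le_sum fun y hy => ?_
      have := hab y hy
      omega
    rw [sum_const, smul_eq_mul, sum_add_distrib, ← mul_sum] at this
    omega

open Finset in
open scoped Classical in
lemma card_forall_not_escapes_mul_pow_le {m s n : ℕ} (S R : Finset (Fin m)) (hSR : Disjoint R S)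
    (hS : #S ≤ n) (hR : n ≤ #R) :
    #{f : BStr3 × Fin m → Fin s | ∀ y ∈ R, ¬ (ThreeGraph.ofFun f).Escapes S R y} *
        s ^ (2 * #R) ≤
      2 ^ (10 * #R) * (n ^ #R * (2 * #R) ^ #R) * s ^ Fintype.card (BStr3 × Fin m) := by
  set C₃ : Finset (BStr3 × Fin m) := ({σ : BStr3 | σ.1.val = 2} : Finset BStr3) ×ˢ R with hC₃
  set C₁₂ : Finset (BStr3 × Fin m) :=
    ({σ : BStr3 | σ.1.val ≤ 1} : Finset BStr3) ×ˢ (R ∪ S) with hC₁₂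
  have hRS : #(R ∪ S) ≤ 2 * #R := (card_union_le R S).trans (by omega)
  have hC : #(C₃ ∪ C₁₂) ≤ 10 * #R := by
    refine (card_union_le _ _).trans ?_
    rw [hC₃, hC₁₂, card_product, card_product, card_bStr3_length_eq_two,
      card_bStr3_length_le_one]
    omega
  let P : BStr3 × Fin m → Finset (BStr3 × Fin m) := fun c =>
    {c.1} ×ˢ if c.1.1.val = 2 then S else {x ∈ R ∪ S | x < c.2}
  have hP₃ : ∀ c ∈ C₃, P c = {c.1} ×ˢ S := by
    intro c hc
    simp only [hC₃, mem_product, mem_filter, mem_univ, true_and] at hc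
    simp only [P, if_pos hc.1]
  have hP₁₂ : ∀ c ∈ C₁₂, P c = {c.1} ×ˢ {x ∈ R ∪ S | x < c.2} := by
    intro c hc
    simp only [hC₁₂, mem_product, mem_filter, mem_univ, true_and] at hc
    simp only [P, if_neg (show ¬ c.1.1.val = 2 by omega)]
  let rank : BStr3 × Fin m → ℕ := fun c =>
    if c.1.1.val = 2 then if c.2 ∈ S then 0 else 1 else c.2.val
  refine (card_exists_repeats_mul_pow_le s (2 * #R) (n ^ #R * (2 * #R) ^ #R) rank (C₃ ∪ C₁₂) P
    ?_ _ ?_).trans (by gcongr; norm_num)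
  · rintro c hc ⟨τ, x⟩ hx
    rcases mem_union.1 hc with hc | hc
    · rw [hP₃ c hc] at hx
      simp only [hC₃, mem_product, mem_filter, mem_univ, true_and, mem_singleton] at hc hx
      have := disjoint_left.1 hSR hc.2
      simp [rank, hx.1, hx.2, hc.1, this]
    · rw [hP₁₂ c hc] at hx
      simp only [hC₁₂, mem_product, mem_filter, mem_univ, true_and, mem_singleton] at hc hx
      have : ¬ c.1.1.val = 2 := by omega
      simp [rank, hx.1, hx.2, this]
  · intro f hf
    obtain ⟨h₁, h₂⟩ := card_le_of_forall_not_escapes f S R (mem_filter.1 hf).2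
    set T₃ : Finset (BStr3 × Fin m) := {c ∈ C₃ | ∃ x ∈ S, f (c.1, x) = f c} with hT₃
    set T₁₂ : Finset (BStr3 × Fin m) :=
      {c ∈ C₁₂ | ∃ x ∈ R ∪ S, x < c.2 ∧ f (c.1, x) = f c} with hT₁₂
    have hdisj : Disjoint T₃ T₁₂ := by
      rw [disjoint_left]
      intro c hc hc'
      simp only [hT₃, hT₁₂, hC₃, hC₁₂, mem_product, mem_filter, mem_univ, true_and] at hc hc'
      omega
    have hrep : ∀ c ∈ T₃ ∪ T₁₂, c ∈ C₃ ∪ C₁₂ ∧ #(P c) ≤ 2 * #R ∧ ∃ c' ∈ P c, f c = f c' := by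
      intro c hc
      rcases mem_union.1 hc with hc | hc
      · obtain ⟨hc, x, hx, hfx⟩ := mem_filter.1 hc
        rw [hP₃ c hc]
        exact ⟨mem_union_left _ hc, by rw [card_product, card_singleton]; omega,
          (c.1, x), by simpa using hx, hfx.symm⟩
      · obtain ⟨hc, x, hx, hlt, hfx⟩ := mem_filter.1 hc
        rw [hP₁₂ c hc]
        refine ⟨mem_union_right _ hc, ?_, (c.1, x), ?_, hfx.symm⟩
        · rw [card_product, card_singleton, one_mul]
          exact (card_filter_le _ _).trans hRS
        · simpa using ⟨mem_union.1 hx, hlt⟩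
    obtain ⟨A, hAT, hA⟩ := exists_subset_card_eq h₁
    obtain ⟨B, hBT, hB⟩ := exists_subset_card_eq (s := (T₃ ∪ T₁₂) \ A) (n := #R) (by
      rw [card_sdiff_of_subset (hAT.trans subset_union_left), card_union_of_disjoint hdisj]
      omega)
    have hAB : Disjoint A B := disjoint_of_subset_right hBT disjoint_sdiff
    have hsub : A ∪ B ⊆ T₃ ∪ T₁₂ :=
      union_subset (hAT.trans subset_union_left) (hBT.trans sdiff_subset)
    refine ⟨A ∪ B, fun c hc => (hrep c (hsub hc)).1, ?_, ?_, fun c hc => (hrep c (hsub hc)).2.2⟩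
    · rw [card_union_of_disjoint hAB]
      omega
    · rw [prod_union hAB]
      refine Nat.mul_le_mul ?_ ?_
      · rw [← hA]
        refine prod_le_pow_card _ _ _ fun c hc => ?_
        rw [hP₃ c (mem_filter.1 (hAT hc)).1, card_product, card_singleton, one_mul]
        exact hS
      · exact (prod_le_pow_card _ _ _ fun c hc =>
          (hrep c (hsub (mem_union_right _ hc))).2.1).trans_eq (by rw [hB])

lemma choose_mul_pow_le (m r : ℕ) : (m.choose r * r ^ r : ℝ) ≤ (3 * m) ^ r := by
  have h₁ : (m.choose r : ℝ) ≤ m ^ r / r.factorial := Nat.choose_le_pow_div r m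
  have h₂ : (r : ℝ) ^ r / r.factorial ≤ Real.exp r :=
    Real.pow_div_factorial_le_exp _ r.cast_nonneg r
  have h₃ : Real.exp r ≤ 3 ^ r := by
    rw [← Real.exp_one_pow]
    exact pow_le_pow_left₀ (Real.exp_pos 1).le Real.exp_one_lt_three.le r
  calc (m.choose r * r ^ r : ℝ) ≤ m ^ r / r.factorial * r ^ r := by gcongr
    _ = m ^ r * (r ^ r / r.factorial) := by ring
    _ ≤ m ^ r * 3 ^ r := by gcongr; exact h₂.trans h₃
    _ = (3 * m) ^ r := by rw [mul_pow, mul_comm]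

open Finset in
lemma card_card_le_le {m n : ℕ} (hn : 1 ≤ n) (hnm : n ≤ m) :
    (#{S : Finset (Fin m) | #S ≤ n} : ℝ) ≤ (3 * m / n) ^ n := by
  have hn0 : (0 : ℝ) < n := by exact_mod_cast hn
  have hnm' : (n : ℝ) ≤ m := by exact_mod_cast hnm
  have hm0 : (0 : ℝ) < m := hn0.trans_le hnm'
  have hle : (n / m : ℝ) ≤ 1 := (div_le_one hm0).2 hnm'
  have hsum : ∑ S : Finset (Fin m), (n / m : ℝ) ^ #S = (n / m + 1) ^ m := by
    rw [← powerset_univ, sum_powerset_apply_card (fun i => (n / m : ℝ) ^ i), card_univ,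
      Fintype.card_fin, add_pow]
    refine sum_congr rfl fun i _ => ?_
    rw [one_pow, nsmul_eq_mul]
    ring
  have hexp : (n / m + 1 : ℝ) ^ m ≤ 3 ^ n := by
    calc (n / m + 1 : ℝ) ^ m ≤ Real.exp (n / m) ^ m := by
          gcongr; exact Real.add_one_le_exp _
      _ = Real.exp 1 ^ n := by
          rw [← Real.exp_nat_mul, ← Real.exp_nat_mul, mul_div_cancel₀ _ hm0.ne', mul_one]
      _ ≤ 3 ^ n := pow_le_pow_left₀ (Real.exp_pos 1).le Real.exp_one_lt_three.le n
  have hlow : (#{S : Finset (Fin m) | #S ≤ n} : ℝ) * (n / m) ^ n ≤ 3 ^ n := by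
    calc (#{S : Finset (Fin m) | #S ≤ n} : ℝ) * (n / m) ^ n
        = ∑ S : Finset (Fin m) with #S ≤ n, (n / m : ℝ) ^ n := by
          rw [sum_const, nsmul_eq_mul]
      _ ≤ ∑ S : Finset (Fin m) with #S ≤ n, (n / m : ℝ) ^ #S :=
          sum_le_sum fun S hS =>
            pow_le_pow_of_le_one (by positivity) hle (mem_filter.1 hS).2
      _ ≤ ∑ S : Finset (Fin m), (n / m : ℝ) ^ #S :=
          sum_le_sum_of_subset_of_nonneg (filter_subset _ _) fun _ _ _ => by positivity
      _ ≤ 3 ^ n := hsum.trans_le hexp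
  calc (#{S : Finset (Fin m) | #S ≤ n} : ℝ) ≤ 3 ^ n / (n / m) ^ n :=
        (le_div_iff₀ (by positivity)).2 hlow
    _ = (3 * m / n) ^ n := by rw [← div_pow, div_div_eq_mul_div]

open Finset in
lemma sum_le_third {m : ℕ} (𝓡 : Finset (Finset (Fin m))) (x : Finset (Fin m) → ℝ) {N : ℝ}
    (hN : 0 ≤ N) (hpos : ∀ R ∈ 𝓡, 0 < #R)
    (hx : ∀ R ∈ 𝓡, m.choose #R * x R ≤ (1 / 4) ^ #R * N) :
    ∑ R ∈ 𝓡, x R ≤ N / 3 := by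
  let w (r : ℕ) : ℝ := if r = 0 then 0 else (1 / 4) ^ r * N / m.choose r
  have hw : ∀ r, 0 ≤ w r := fun r => by
    simp only [w]
    split_ifs <;> positivity
  have hgeom : ∀ k : ℕ, ∑ i ∈ range k, (1 / 4 : ℝ) ^ (i + 1) * N = (1 - (1 / 4) ^ k) * N / 3 := by
    intro k
    induction k with
    | zero => simp
    | succ k ih => rw [sum_range_succ, ih]; ring
  calc ∑ R ∈ 𝓡, x R ≤ ∑ R ∈ 𝓡, w #R := by
        refine sum_le_sum fun R hR => ?_
        have hc : (0 : ℝ) < m.choose #R := by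
          exact_mod_cast Nat.choose_pos (card_finset_fin_le R)
        simp only [w, if_neg (hpos R hR).ne']
        rw [le_div_iff₀ hc, mul_comm]
        exact hx R hR
    _ ≤ ∑ R : Finset (Fin m), w #R :=
        sum_le_sum_of_subset_of_nonneg (subset_univ _) fun _ _ _ => hw _
    _ = ∑ r ∈ range (m + 1), m.choose r • w r := by
        rw [← powerset_univ, sum_powerset_apply_card, card_univ, Fintype.card_fin]
    _ = ∑ i ∈ range m, (1 / 4 : ℝ) ^ (i + 1) * N := by
        rw [sum_range_succ']
        simp only [w, if_true, smul_zero, add_zero, Nat.succ_ne_zero, if_false, nsmul_eq_mul]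
        refine sum_congr rfl fun i hi => mul_div_cancel₀ _ ?_
        exact_mod_cast (Nat.choose_pos (mem_range.1 hi)).ne'
    _ = (1 - (1 / 4) ^ m) * N / 3 := hgeom m
    _ ≤ N / 3 := by
        have : 0 ≤ (1 / 4 : ℝ) ^ m * N := by positivity
        linarith

open Finset in
/-- For all sufficiently large `m` and all integers `n` with `1 ≤ n ≤ m`, there
exists an `(m,s,3)`-graph with `s = ⌈500·√(m·n·log₂(2m/n))⌉` that is admissible
for sets of size at most `n`. -/
theorem admissible_three_graph_exists :
    ∃ M : ℕ, ∀ m : ℕ, M ≤ m → ∀ n : ℕ, 1 ≤ n → n ≤ m →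
      ∃ G : ThreeGraph m
        (⌈500 * Real.sqrt ((m : ℝ) * (n : ℝ) * Real.logb 2 (2 * (m : ℝ) / (n : ℝ)))⌉₊),
        G.Admissible n := by
  classical
  refine ⟨0, fun m _ n hn hnm => ?_⟩
  set L : ℝ := Real.logb 2 (2 * (m : ℝ) / (n : ℝ)) with hL
  set k : ℕ := ⌈(n : ℝ) * L⌉₊ with hk
  set s : ℕ := ⌈500 * Real.sqrt ((m : ℝ) * (n : ℝ) * L)⌉₊ with hs
  have hn0 : (0 : ℝ) < n := by exact_mod_cast hn
  have hn1 : (1 : ℝ) ≤ n := by exact_mod_cast hn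
  have hnm' : (n : ℝ) ≤ m := by exact_mod_cast hnm
  have hm0 : (0 : ℝ) < m := hn0.trans_le hnm'
  have hL1 : 1 ≤ L := by
    rw [hL, Real.le_logb_iff_rpow_le one_lt_two (by positivity), Real.rpow_one,
      le_div_iff₀ hn0]
    linarith
  have hnL : (n : ℝ) ≤ n * L := le_mul_of_one_le_right hn0.le hL1
  have hkL : n * L ≤ (k : ℝ) := Nat.le_ceil _
  have hkL' : (k : ℝ) < n * L + 1 := Nat.ceil_lt_add_one (by positivity)
  have hnk : n ≤ k := by exact_mod_cast hnL.trans hkL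
  have hs2 : 250000 * (m * n * L) ≤ (s : ℝ) ^ 2 := by
    have h := pow_le_pow_left₀ (by positivity) (Nat.le_ceil (500 * √((m : ℝ) * n * L))) 2
    rw [mul_pow, Real.sq_sqrt (by positivity)] at h
    linarith
  have hs0 : (0 : ℝ) < s := by
    have : (0 : ℝ) < 250000 * (m * n * L) := by positivity
    refine (Nat.cast_nonneg s).lt_of_ne fun h => ?_
    rw [← h] at hs2
    linarith
  set N : ℝ := (s : ℝ) ^ Fintype.card (BStr3 × Fin m) with hN
  have hN0 : 0 < N := by positivity
  set B₁ : Finset (Fin m) → Finset (BStr3 × Fin m → Fin s) := fun R =>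
    {f | ((ThreeGraph.ofFun f).Gamma ↑R).ncard < 5 * #R} with hB₁
  set B₂ : Finset (Fin m) → Finset (Fin m) → Finset (BStr3 × Fin m → Fin s) := fun S R =>
    {f | Disjoint R S ∧ ∀ y ∈ R, ¬ (ThreeGraph.ofFun f).Escapes S R y} with hB₂
  set 𝓢 : Finset (Finset (Fin m)) := {S | #S ≤ n} with h𝓢
  set 𝓡₁ : Finset (Finset (Fin m)) := {R | 0 < #R ∧ #R ≤ n + k} with h𝓡₁
  set 𝓡₂ : Finset (Finset (Fin m)) := {R | k < #R} with h𝓡₂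
  have hcancel : ∀ (r : ℕ) (x y : ℝ), 0 ≤ y → y ≤ s ^ 2 / 4 → x * s ^ (2 * r) ≤ y ^ r * N →
      x ≤ (1 / 4) ^ r * N := by
    intro r x y hy0 hy h
    refine le_of_mul_le_mul_right (h.trans ?_) (pow_pos hs0 (2 * r))
    calc y ^ r * N ≤ (s ^ 2 / 4) ^ r * N := by gcongr
      _ = (1 / 4) ^ r * N * s ^ (2 * r) := by rw [pow_mul, div_pow, div_pow, one_pow]; ring
  have hsum₁ : ∑ R ∈ 𝓡₁, (#(B₁ R) : ℝ) ≤ N / 3 := by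
    refine sum_le_third 𝓡₁ _ hN0.le (fun R hR => (mem_filter.1 hR).2.1) fun R hR => ?_
    have hr : (#R : ℝ) ≤ n + k := by exact_mod_cast (mem_filter.1 hR).2.2
    refine hcancel _ _ (384 * m * #R) (by positivity) ?_ ?_
    · have : (#R : ℝ) ≤ 3 * (n * L) := by linarith
      nlinarith [mul_le_mul_of_nonneg_left this hm0.le]
    · have hc : (#(B₁ R) : ℝ) * s ^ (2 * #R) ≤ 2 ^ (7 * #R) * #R ^ (2 * #R) * N := by
        rw [hN]
        exact_mod_cast card_small_neighborhood_mul_pow_le (s := s) R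
      calc (m.choose #R * #(B₁ R) : ℝ) * s ^ (2 * #R)
          = m.choose #R * (#(B₁ R) * s ^ (2 * #R)) := by ring
        _ ≤ m.choose #R * (2 ^ (7 * #R) * #R ^ (2 * #R) * N) := by gcongr
        _ = (m.choose #R * #R ^ #R) * (128 * #R) ^ #R * N := by
            rw [pow_mul, mul_pow, two_mul, pow_add]; norm_num; ring
        _ ≤ (3 * m) ^ #R * (128 * #R) ^ #R * N := by
            gcongr; exact choose_mul_pow_le m #R
        _ = (384 * m * #R) ^ #R * N := by rw [← mul_pow]; ring_nf
  have hsum₂ : ∑ R ∈ 𝓡₂, ∑ S ∈ 𝓢, (#(B₂ S R) : ℝ) ≤ N / 3 := by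
    refine sum_le_third 𝓡₂ _ hN0.le (fun R hR => (Nat.zero_le k).trans_lt (mem_filter.1 hR).2)
      fun R hR => ?_
    have hkr : k < #R := (mem_filter.1 hR).2
    refine hcancel _ _ (18432 * m * n) (by positivity) ?_ ?_
    · nlinarith [mul_le_mul_of_nonneg_left hL1 (mul_nonneg hm0.le hn0.le),
        mul_pos hm0 hn0]
    · have hc : ∀ S ∈ 𝓢, (#(B₂ S R) : ℝ) * s ^ (2 * #R) ≤
          2 ^ (10 * #R) * (n ^ #R * (2 * #R) ^ #R) * N := by
        intro S hS
        by_cases hRS : Disjoint R S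
        · have := card_forall_not_escapes_mul_pow_le (s := s) S R hRS (mem_filter.1 hS).2
            (hnk.trans hkr.le)
          simp only [hB₂, hRS, true_and, hN]
          exact_mod_cast this
        · simp only [hB₂, hRS, false_and, filter_false, card_empty, Nat.cast_zero, zero_mul]
          positivity
      have h𝓢3 : (#𝓢 : ℝ) ≤ 3 ^ #R := by
        have hkr' : (k : ℝ) ≤ #R := by exact_mod_cast hkr.le
        have hpow : (2 * (m : ℝ) / n) ^ n ≤ 2 ^ #R := by
          have h2 : (2 : ℝ) ^ L = 2 * m / n :=
            Real.rpow_logb two_pos (by norm_num) (by positivity)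
          rw [← h2, ← Real.rpow_natCast, ← Real.rpow_mul two_pos.le, ← Real.rpow_natCast]
          exact Real.rpow_le_rpow_of_exponent_le one_le_two (by linarith)
        calc (#𝓢 : ℝ) ≤ (3 * m / n) ^ n := card_card_le_le hn hnm
          _ = (3 / 2) ^ n * (2 * m / n) ^ n := by rw [← mul_pow]; ring_nf
          _ ≤ (3 / 2) ^ #R * 2 ^ #R := by
              gcongr
              · norm_num
              · omega
          _ = 3 ^ #R := by rw [← mul_pow]; norm_num
      calc (m.choose #R * ∑ S ∈ 𝓢, (#(B₂ S R) : ℝ)) * s ^ (2 * #R)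
          = m.choose #R * ∑ S ∈ 𝓢, #(B₂ S R) * (s : ℝ) ^ (2 * #R) := by rw [← sum_mul]; ring
        _ ≤ m.choose #R * ∑ _S ∈ 𝓢, 2 ^ (10 * #R) * (n ^ #R * (2 * #R) ^ #R) * N := by
            exact mul_le_mul_of_nonneg_left (sum_le_sum hc) (Nat.cast_nonneg _)
        _ = (m.choose #R * #R ^ #R) * #𝓢 * (2048 * n) ^ #R * N := by
            rw [sum_const, nsmul_eq_mul, pow_mul, mul_pow, mul_pow,
              show (2048 : ℝ) = 2 ^ 10 * 2 by norm_num, mul_pow]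
            ring
        _ ≤ (3 * m) ^ #R * 3 ^ #R * (2048 * n) ^ #R * N := by
            gcongr; exact choose_mul_pow_le m #R
        _ = (18432 * m * n) ^ #R * N := by rw [← mul_pow, ← mul_pow]; ring_nf
  set bad := 𝓡₁.biUnion B₁ ∪ 𝓡₂.biUnion fun R => 𝓢.biUnion fun S => B₂ S R with hbad
  have hbad_card : (#bad : ℝ) < #(univ : Finset (BStr3 × Fin m → Fin s)) := by
    have h : #bad ≤ ∑ R ∈ 𝓡₁, #(B₁ R) + ∑ R ∈ 𝓡₂, ∑ S ∈ 𝓢, #(B₂ S R) :=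
      (card_union_le _ _).trans (Nat.add_le_add card_biUnion_le
        (card_biUnion_le.trans (sum_le_sum fun R _ => card_biUnion_le)))
    have h' : (#bad : ℝ) ≤ ∑ R ∈ 𝓡₁, (#(B₁ R) : ℝ) + ∑ R ∈ 𝓡₂, ∑ S ∈ 𝓢, (#(B₂ S R) : ℝ) := by
      exact_mod_cast h
    have hcard : (#(univ : Finset (BStr3 × Fin m → Fin s)) : ℝ) = N := by
      rw [card_univ, Fintype.card_fun, Fintype.card_fin, Nat.cast_pow]
    linarith
  obtain ⟨f, -, hf⟩ := exists_mem_notMem_of_card_lt_card (Nat.cast_lt.1 hbad_card)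
  simp only [hbad, mem_union, mem_biUnion, not_or, not_exists, not_and] at hf
  refine ⟨ThreeGraph.ofFun f, fun R hR => ?_, fun S R hS hRS hR => ?_⟩
  · rcases Nat.eq_zero_or_pos #R with h0 | h0
    · simp [h0]
    · by_contra! h
      exact hf.1 R (by simpa [h𝓡₁] using ⟨card_pos.1 h0, hR⟩) (by simpa [hB₁] using h)
  · by_contra! h
    refine hf.2 R (by simpa [h𝓡₂] using hR) S (by simpa [h𝓢] using hS) ?_
    simp only [hB₂, mem_filter, mem_univ, true_and]
    refine ⟨hRS, fun y hy hesc => ?_⟩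
    have := h y hy
    rcases hesc with hesc | hesc
    · exact (Set.nonempty_iff_ne_empty.1 this.1) hesc
    · exact absurd hesc.2 (not_le.2 (this.2 hesc.1))
end

section
/- Suppose t ≥ 2 and s, m, n are positive integers such that 4^t ≤ n ≤ m^{1/(2(t−1))} and s ≤ (1/15)·m^{(1/(t−1))·(1 − 4^t/n)}. Then for every (m,s,t)-query scheme {T_u}_{u∈[m]}, there are disjoint sets S, T ⊆ [m], each of size at most n, such that for every memory assignment σ ∈ {0,1}^s, either some u ∈ S has T_u(σ) = No or some u ∈ T has T_u(σ) = Yes. -/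
/-- A Boolean decision tree over an `s`-bit memory: each internal node probes a
bit at an index in `[s]`, each leaf is marked Yes (`true`) or No (`false`). -/
inductive DTree (s : ℕ) : Type
  | leaf (b : Bool) : DTree s
  | node (i : Fin s) (f0 f1 : DTree s) : DTree s

/-- Depth of a decision tree. -/
def DTree.depth {s : ℕ} : DTree s → ℕ
  | .leaf _ => 0
  | .node _ f0 f1 => max f0.depth f1.depth + 1

/-- Evaluating a decision tree on a memory `σ : Fin s → Bool`: at a node probing
index `i`, follow the edge labeled by the bit `σ i`. -/
def DTree.eval {s : ℕ} : DTree s → (Fin s → Bool) → Bool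
  | .leaf b, _ => b
  | .node i f0 f1, σ => if σ i then f1.eval σ else f0.eval σ

/-- An `(m,n,s,t)`-scheme: a storing scheme `φ` mapping subsets of `[m]` of size at
most `n` to `s`-bit strings, together with a family of decision trees of depth at
most `t` answering membership queries correctly. -/
def SchemeExists (m n s t : ℕ) : Prop :=
  ∃ (φ : Finset (Fin m) → (Fin s → Bool)) (T : Fin m → DTree s),
    (∀ u : Fin m, (T u).depth ≤ t) ∧
    ∀ S : Finset (Fin m), S.card ≤ n → ∀ u : Fin m, ((T u).eval (φ S) = true ↔ u ∈ S)

/-- `sFun m n t` is the minimum `s` such that an `(m,n,s,t)`-scheme exists. -/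
noncomputable def sFun (m n t : ℕ) : ℕ := sInf {s : ℕ | SchemeExists m n s t}

/-- A set `Q` of Boolean queries is refutable at cost `N` if at most `N` of them can be given
answers that no memory realizes. -/
def Refutable {α X : Type*} (g : α → X → Bool) (Q : Finset α) (N : ℕ) : Prop :=
  ∃ P ⊆ Q, P.card ≤ N ∧ ∃ a : α → Bool, ∀ σ, ∃ u ∈ P, g u σ ≠ a u

theorem DTree.exists_probe {s k : ℕ} (hs : 0 < s) (A : DTree s) (hA : A.depth ≤ k + 1) :
    ∃ (i : Fin s) (B C : DTree s), B.depth ≤ k ∧ C.depth ≤ k ∧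
      ∀ σ, A.eval σ = if σ i then C.eval σ else B.eval σ := by
  cases A with
  | leaf b => exact ⟨⟨0, hs⟩, .leaf b, .leaf b, by simp [DTree.depth], by simp [DTree.depth],
      fun σ => by simp [DTree.eval]⟩
  | node i B C =>
    simp only [DTree.depth, add_le_add_iff_right, max_le_iff] at hA
    exact ⟨i, B, C, hA.1, hA.2, fun σ => rfl⟩

theorem DTree.eval_eq_of_depth_eq_zero {s : ℕ} (A : DTree s) (hA : A.depth ≤ 0) :
    ∃ c, ∀ σ, A.eval σ = c := by
  cases A with
  | leaf b => exact ⟨b, fun σ => rfl⟩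
  | node i B C => simp [DTree.depth] at hA

/-- In a tree of depth at most one, some bit can be forced to either value by prescribing the
answer. -/
theorem DTree.exists_forced_bit {s : ℕ} (hs : 0 < s) (A : DTree s) (hA : A.depth ≤ 1) :
    ∃ j : Fin s, ∀ b : Bool, ∃ a : Bool, ∀ σ, A.eval σ = a → σ j = b := by
  obtain ⟨j, B, C, hB, hC, h⟩ := A.exists_probe hs (k := 0) hA
  obtain ⟨c₀, h₀⟩ := B.eval_eq_of_depth_eq_zero hB
  obtain ⟨c₁, h₁⟩ := C.eval_eq_of_depth_eq_zero hC
  refine ⟨j, fun b => ?_⟩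
  simp only [h, h₀, h₁]
  by_cases hc : c₀ = c₁
  · subst hc
    exact ⟨!c₀, fun σ hσ => by simp at hσ⟩
  · refine ⟨if b then c₁ else c₀, fun σ => ?_⟩
    cases b <;> cases hσ : σ j <;> simp [hc, Ne.symm hc]

/-- The edges `(vertex, letter)` traversed by the walk that reads the word `w` from `v`. -/
def walkEdges {X L : Type*} (step : X → L → X) : X → List L → List (X × L)
  | _, [] => []
  | v, l :: w => (v, l) :: walkEdges step (step v l) w

theorem length_walkEdges {X L : Type*} (step : X → L → X) (v : X) (w : List L) :
    (walkEdges step v w).length = w.length := by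
  induction w generalizing v with
  | nil => rfl
  | cons l w ih => simp [walkEdges, ih]

theorem walkEdges_append_singleton {X L : Type*} (step : X → L → X) (v : X) (w : List L) (l : L) :
    walkEdges step v (w ++ [l]) = walkEdges step v w ++ [(w.foldl step v, l)] := by
  induction w generalizing v with
  | nil => rfl
  | cons l' w ih => simp [walkEdges, ih]

theorem exists_prefix_of_mem_walkEdges {X L : Type*} (step : X → L → X) (v : X) (w : List L)
    (x : X) (l : L) (h : (x, l) ∈ walkEdges step v w) :
    ∃ p q, w = p ++ l :: q ∧ p.foldl step v = x := by
  induction w generalizing v with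
  | nil => simp [walkEdges] at h
  | cons l' w ih =>
    simp only [walkEdges, List.mem_cons, Prod.mk.injEq] at h
    rcases h with ⟨rfl, rfl⟩ | h
    · exact ⟨[], w, rfl, rfl⟩
    · obtain ⟨p, q, rfl, hp⟩ := ih _ h
      exact ⟨l' :: p, q, rfl, hp⟩

theorem eq_true_of_forall_mem_walkEdges {X L : Type*} (step : X → L → X) (τ : X → Bool) (v : X)
    (w : List L) (hv : τ v = true)
    (h : ∀ e ∈ walkEdges step v w, τ e.1 = true → τ (step e.1 e.2) = true) :
    τ (w.foldl step v) = true := by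
  induction w generalizing v with
  | nil => simpa using hv
  | cons l w ih =>
    simp only [walkEdges, List.mem_cons, forall_eq_or_imp] at h
    exact ih _ (h.1 hv) h.2

/-- Two words of length at most `r` lead to the same vertex. -/
theorem exists_foldl_eq {X : Type*} [Fintype X] {d r : ℕ} (hr : 1 ≤ r)
    (hX : Fintype.card X ≤ d ^ r) (step : X → Fin d → X) (v : X) :
    ∃ w w' : List (Fin d), w.length ≤ r ∧ w'.length ≤ r ∧ w ≠ w' ∧
      w.foldl step v = w'.foldl step v := by
  by_contra! hne
  let φ : Option (Fin r → Fin d) → List (Fin d) := fun o => o.elim [] List.ofFn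
  have hlen : ∀ o, (φ o).length ≤ r := by
    rintro (_ | f) <;> simp [φ]
  have hφ : Function.Injective φ := by
    rintro (_ | f) (_ | f') h
    · rfl
    · have := congrArg List.length h
      simp [φ] at this
      omega
    · have := congrArg List.length h
      simp [φ] at this
      omega
    · simp only [φ, Option.elim] at h
      rw [List.ofFn_injective h]
  have hinj : Function.Injective fun o => (φ o).foldl step v := by
    intro o o' h
    by_contra hoo
    exact hne _ _ (hlen o) (hlen o') (fun h' => hoo (hφ h')) h
  have := Fintype.card_le_of_injective _ hinj
  simp at this
  omega

/-- In a digraph of out-degree `d` on at most `d ^ r` vertices, any vertex `v` can be prevented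
from being true by implications placed on at most `2 * r` edges. -/
theorem exists_edges_refuting {X : Type*} [Fintype X] [DecidableEq X] {d r : ℕ} (hr : 1 ≤ r)
    (hX : Fintype.card X ≤ d ^ r) (step : X → Fin d → X) (v : X) :
    ∃ P : Finset (X × Fin d), P.card ≤ 2 * r ∧ ∃ g : X × Fin d → Bool,
      ∀ τ : X → Bool, τ v = true → ∃ e ∈ P, τ e.1 = true ∧ τ (step e.1 e.2) = g e := by
  classical
  have hex : ∃ k, ∃ w w' : List (Fin d), w.length ≤ k ∧ w'.length ≤ k ∧ w ≠ w' ∧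
      w.foldl step v = w'.foldl step v := ⟨r, exists_foldl_eq hr hX step v⟩
  obtain ⟨k, hkr, ⟨w, w', hw, hw', hne, heq⟩, hmin⟩ :
      ∃ k, k ≤ r ∧ (∃ w w' : List (Fin d), w.length ≤ k ∧ w'.length ≤ k ∧ w ≠ w' ∧
      w.foldl step v = w'.foldl step v) ∧ ∀ k' < k, ∀ w w' : List (Fin d), w.length ≤ k' →
        w'.length ≤ k' → w.foldl step v = w'.foldl step v → w = w' := by
    refine ⟨Nat.find hex, Nat.find_min' hex (exists_foldl_eq hr hX step v), Nat.find_spec hex, ?_⟩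
    intro k' hk' w w' h h' he
    by_contra hn
    exact Nat.find_min hex hk' ⟨w, w', h, h', hn, he⟩
  wlog hlen : w.length = k generalizing w w'
  · have hlen' : w'.length = k := by
      by_contra hlen'
      have h1 : w.length ≤ k - 1 := by omega
      have h2 : w'.length ≤ k - 1 := by omega
      exact hne (hmin (k - 1) (by omega) w w' h1 h2 heq)
    exact this w' w hw' hw hne.symm heq.symm hlen'
  rcases List.eq_nil_or_concat w with rfl | ⟨p, l, rfl⟩
  · simp only [List.length_nil] at hlen
    have : w' = [] := List.eq_nil_of_length_eq_zero (by omega)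
    exact absurd this.symm hne
  simp only [List.concat_eq_append] at *
  simp only [List.length_append, List.length_singleton] at hlen
  set e₀ : X × Fin d := (p.foldl step v, l) with he₀
  have hpre : ∀ q : List (Fin d), q.length < k → q.foldl step v = p.foldl step v → q = p :=
    fun q hq h => hmin (k - 1) (by omega) q p (by omega) (by omega) h
  have hp : e₀ ∉ walkEdges step v p := by
    intro h
    obtain ⟨q, q', hq, hqe⟩ := exists_prefix_of_mem_walkEdges step v p _ _ h
    have hl := congrArg List.length hq
    simp only [List.length_append, List.length_cons] at hl
    have := congrArg List.length (hpre q (by omega) hqe)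
    omega
  have hp' : e₀ ∉ walkEdges step v w' := by
    intro h
    obtain ⟨q, q', rfl, hqe⟩ := exists_prefix_of_mem_walkEdges step v w' _ _ h
    simp only [List.length_append, List.length_cons] at hw'
    obtain rfl := hpre q (by omega) hqe
    have : q' = [] := List.eq_nil_of_length_eq_zero (by omega)
    subst this
    exact hne rfl
  refine ⟨(walkEdges step v (p ++ [l])).toFinset ∪ (walkEdges step v w').toFinset, ?_,
    fun e => decide (e = e₀), ?_⟩
  · refine (Finset.card_union_le _ _).trans ?_
    have h1 := List.toFinset_card_le (walkEdges step v (p ++ [l]))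
    have h2 := List.toFinset_card_le (walkEdges step v w')
    rw [length_walkEdges] at h1 h2
    simp only [List.length_append, List.length_singleton] at h1
    omega
  · intro τ hτ
    by_contra! hcon
    have key : ∀ e, e ∈ walkEdges step v p ∨ e ∈ walkEdges step v w' → τ e.1 = true →
        τ (step e.1 e.2) = true := by
      intro e he h1
      have h2 := hcon e (by
        rw [walkEdges_append_singleton]
        simp only [Finset.mem_union, List.mem_toFinset, List.mem_append]
        tauto) h1
      have h3 : e ≠ e₀ := by
        rintro rfl
        tauto
      simpa [h3] using h2
    have h1 := eq_true_of_forall_mem_walkEdges step τ v p hτ fun e he => key e (.inl he)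
    have h2 := eq_true_of_forall_mem_walkEdges step τ v w' hτ fun e he => key e (.inr he)
    have h3 := hcon e₀ (by rw [walkEdges_append_singleton]; simp [he₀]) h1
    rw [← heq, List.foldl_append] at h2
    simp only [List.foldl_cons, List.foldl_nil] at h2
    simp [he₀, h2] at h3

/-- A multigraph with at least `c` times as many edges as vertices has a nonempty vertex set `U`
inside which every `B ⊆ U` meets at least `c * #B` edges. -/
theorem exists_subset_forall_incident {V ε : Type*} [Fintype V] [DecidableEq V] [Nonempty V]
    [DecidableEq ε] (E : Finset ε) (x y : ε → V) (c : ℕ) (hE : c * Fintype.card V ≤ E.card) :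
    ∃ U : Finset V, U.Nonempty ∧ ∀ B ⊆ U,
      c * B.card ≤ {e ∈ E | x e ∈ U ∧ y e ∈ U ∧ (x e ∈ B ∨ y e ∈ B)}.card := by
  classical
  let 𝒰 : Finset (Finset V) :=
    {U | U.Nonempty ∧ c * U.card ≤ {e ∈ E | x e ∈ U ∧ y e ∈ U}.card}
  have h𝒰 : 𝒰.Nonempty := ⟨Finset.univ, by simpa [𝒰] using hE⟩
  obtain ⟨U, hU, hmin⟩ := Finset.exists_min_image 𝒰 Finset.card h𝒰
  obtain ⟨hUne, hUc⟩ : U.Nonempty ∧ c * U.card ≤ {e ∈ E | x e ∈ U ∧ y e ∈ U}.card := by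
    simpa [𝒰] using hU
  refine ⟨U, hUne, fun B hB => ?_⟩
  rcases B.eq_empty_or_nonempty with rfl | hBne
  · simp
  have hcard : (U \ B).card + B.card = U.card := Finset.card_sdiff_add_card_eq_card hB
  have hsplit : {e ∈ E | x e ∈ U ∧ y e ∈ U}.card ≤
      {e ∈ E | x e ∈ U \ B ∧ y e ∈ U \ B}.card +
        {e ∈ E | x e ∈ U ∧ y e ∈ U ∧ (x e ∈ B ∨ y e ∈ B)}.card := by
    refine le_trans (Finset.card_le_card ?_) (Finset.card_union_le _ _)
    intro e he
    simp only [Finset.mem_union, Finset.mem_filter, Finset.mem_sdiff] at he ⊢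
    tauto
  have hsmall : {e ∈ E | x e ∈ U \ B ∧ y e ∈ U \ B}.card ≤ c * (U \ B).card := by
    rcases (U \ B).eq_empty_or_nonempty with h | h
    · simp [h]
    · by_contra! hlt
      have := hmin (U \ B) (by
        simp only [𝒰, Finset.mem_filter, Finset.mem_univ, true_and]
        exact ⟨h, hlt.le⟩)
      have := hBne.card_pos
      omega
  have : c * U.card = c * (U \ B).card + c * B.card := by rw [← hcard, mul_add]
  omega

/-- In a multigraph with at least `c` times as many edges as vertices, some nonempty vertex set
`U` admits an assignment of `c` private incident edges inside `U` to each of its vertices. -/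
theorem exists_private_edges {V ε κ : Type*} [Fintype V] [DecidableEq V] [Nonempty V]
    [DecidableEq ε] [Fintype κ] (E : Finset ε) (x y : ε → V)
    (hE : Fintype.card κ * Fintype.card V ≤ E.card) :
    ∃ U : Finset V, U.Nonempty ∧ ∃ f : U × κ → ε, Function.Injective f ∧
      ∀ v : U, ∀ l, f (v, l) ∈ E ∧ x (f (v, l)) ∈ U ∧ y (f (v, l)) ∈ U ∧
        (x (f (v, l)) = v ∨ y (f (v, l)) = v) := by
  classical
  obtain ⟨U, hU, h⟩ := exists_subset_forall_incident E x y _ hE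
  let inc : U × κ → Finset ε :=
    fun p => {e ∈ E | x e ∈ U ∧ y e ∈ U ∧ (x e = p.1 ∨ y e = p.1)}
  obtain ⟨f, hf, hfm⟩ := (Finset.all_card_le_biUnion_card_iff_exists_injective inc).1 (by
    intro A
    let B₀ : Finset U := A.image Prod.fst
    let B : Finset V := B₀.map (Function.Embedding.subtype _)
    have hAB : A.card ≤ Fintype.card κ * B.card := by
      have : A ⊆ B₀ ×ˢ Finset.univ := by
        intro p hp
        simp only [B₀, Finset.mem_product, Finset.mem_image, Finset.mem_univ, and_true]
        exact ⟨p, hp, rfl⟩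
      have := Finset.card_le_card this
      rw [Finset.card_product, Finset.card_univ] at this
      simp only [B, Finset.card_map]
      linarith [mul_comm B₀.card (Fintype.card κ)]
    have hBU : B ⊆ U := by
      intro v hv
      simp only [B, Finset.mem_map, Function.Embedding.coe_subtype] at hv
      obtain ⟨a, -, rfl⟩ := hv
      exact a.2
    refine hAB.trans ((h B hBU).trans (Finset.card_le_card ?_))
    intro e he
    simp only [Finset.mem_filter] at he
    obtain ⟨heE, hx, hy, hxy⟩ := he
    have hmem : ∀ v ∈ B, ∃ p ∈ A, (p.1 : V) = v := by
      intro v hv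
      simp only [B, B₀, Finset.mem_map, Finset.mem_image, Function.Embedding.coe_subtype] at hv
      obtain ⟨a, ⟨p, hp, rfl⟩, rfl⟩ := hv
      exact ⟨p, hp, rfl⟩
    rw [Finset.mem_biUnion]
    rcases hxy with hB | hB <;> obtain ⟨p, hp, hpe⟩ := hmem _ hB <;>
      exact ⟨p, hp, by simp [inc, heE, hx, hy, hpe]⟩)
  refine ⟨U, hU, f, hf, fun v l => ?_⟩
  have := hfm (v, l)
  simp only [inc, Finset.mem_filter] at this
  exact this

/-- A dense multigraph contains `4 * r` edges whose endpoints can be given forbidden values so that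
every assignment of bits to the vertices is excluded. -/
theorem exists_unsatisfiable_edges {V ε : Type*} [Fintype V] [DecidableEq V] [Nonempty V]
    [DecidableEq ε] (E : Finset ε) (x y : ε → V) (d r : ℕ) (hr : 1 ≤ r)
    (hV : Fintype.card V ≤ d ^ r) (hE : 2 * d * Fintype.card V ≤ E.card) :
    ∃ F ⊆ E, F.card ≤ 4 * r ∧ ∃ b c : ε → Bool,
      ∀ σ : V → Bool, ∃ e ∈ F, σ (x e) = b e ∧ σ (y e) = c e := by
  classical
  obtain ⟨U, ⟨v₀, hv₀⟩, f, hf, hfE⟩ :=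
    exists_private_edges (κ := Bool × Fin d) E x y (by simpa using hE)
  let other : U → Bool × Fin d → V :=
    fun v l => if x (f (v, l)) = v then y (f (v, l)) else x (f (v, l))
  have hother : ∀ v l, other v l ∈ U := by
    intro v l
    obtain ⟨-, hx, hy, -⟩ := hfE v l
    by_cases h : x (f (v, l)) = v <;> simp [other, h, hx, hy]
  let step : Bool → U → Fin d → U := fun β v l => ⟨other v (β, l), hother v _⟩
  have hU : Fintype.card U ≤ d ^ r := by
    rw [Fintype.card_coe]
    exact (Finset.card_le_univ U).trans hV
  choose P hP g hg using fun β => exists_edges_refuting hr hU (step β) ⟨v₀, hv₀⟩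
  let ed : Bool → U × Fin d → ε := fun β p => f (p.1, (β, p.2))
  let B : U × (Bool × Fin d) → Bool := fun p =>
    if x (f p) = p.1 then p.2.1 else (p.2.1 == g p.2.1 (p.1, p.2.2))
  let C : U × (Bool × Fin d) → Bool := fun p =>
    if x (f p) = p.1 then (p.2.1 == g p.2.1 (p.1, p.2.2)) else p.2.1
  refine ⟨(P true).image (ed true) ∪ (P false).image (ed false), ?_, ?_,
    Function.extend f B (fun _ => false), Function.extend f C (fun _ => false), ?_⟩
  · intro e he
    simp only [Finset.mem_union, Finset.mem_image] at he
    rcases he with ⟨p, -, rfl⟩ | ⟨p, -, rfl⟩ <;> exact (hfE _ _).1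
  · refine (Finset.card_union_le _ _).trans ?_
    have h1 := (Finset.card_image_le (s := P true) (f := ed true)).trans (hP true)
    have h2 := (Finset.card_image_le (s := P false) (f := ed false)).trans (hP false)
    omega
  · intro σ
    obtain ⟨p, hp, hp1, hp2⟩ := hg (σ v₀) (fun v => σ v == σ v₀) (by simp)
    refine ⟨ed (σ v₀) p, ?_, ?_⟩
    · cases h : σ v₀ <;> rw [h] at hp <;> simp only [Finset.mem_union]
      · exact .inr (Finset.mem_image_of_mem _ hp)
      · exact .inl (Finset.mem_image_of_mem _ hp)
    · have hb : ∀ a b c : Bool, (a == b) = c → a = (b == c) := by decide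
      have h1 : σ p.1 = σ v₀ := by simpa using hp1
      have h2 : σ (other p.1 (σ v₀, p.2)) = (σ v₀ == g (σ v₀) p) := hb _ _ _ hp2
      simp only [ed, hf.extend_apply, B, C]
      by_cases hx : x (f (p.1, (σ v₀, p.2))) = p.1
      · simp only [other, hx, if_true] at h2 ⊢
        exact ⟨h1, h2⟩
      · have hy := ((hfE p.1 (σ v₀, p.2)).2.2.2).resolve_left hx
        simp only [other, hx, if_false] at h2 ⊢
        exact ⟨h2, by rw [hy]; exact h1⟩

/-- Many elements coloured with `s` colours contain many disjoint monochromatic pairs. -/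
theorem exists_disjoint_pairs {α : Type*} [DecidableEq α] {s : ℕ} (f : α → Fin s) (e : ℕ)
    (Q : Finset α) (hQ : 2 * e + s ≤ Q.card + 1) :
    ∃ E : Finset (α × α), E.card = e ∧
      (∀ p ∈ E, p.1 ∈ Q ∧ p.2 ∈ Q ∧ p.1 ≠ p.2 ∧ f p.1 = f p.2) ∧
      ∀ p ∈ E, ∀ q ∈ E, p ≠ q → p.1 ≠ q.1 ∧ p.1 ≠ q.2 ∧ p.2 ≠ q.1 ∧ p.2 ≠ q.2 := by
  induction e generalizing Q with
  | zero => exact ⟨∅, by simp⟩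
  | succ e ih =>
    obtain ⟨u, hu, v, hv, huv, hf⟩ := Finset.exists_ne_map_eq_of_card_lt_of_maps_to
      (s := Q) (t := Finset.univ) (f := f) (by simp; omega) (by simp [Set.MapsTo])
    have hc : ((Q.erase u).erase v).card + 2 = Q.card := by
      have h1 := Finset.card_erase_add_one hu
      have h2 := Finset.card_erase_add_one (Finset.mem_erase.2 ⟨huv.symm, hv⟩)
      omega
    obtain ⟨E, hE, hEQ, hd⟩ := ih ((Q.erase u).erase v) (by omega)
    simp only [Finset.mem_erase] at hEQ
    have hnot : (u, v) ∉ E := fun h => (hEQ _ h).1.2.1 rfl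
    refine ⟨insert (u, v) E, by rw [Finset.card_insert_of_notMem hnot, hE], ?_, ?_⟩
    · intro p hp
      rcases Finset.mem_insert.1 hp with rfl | hp
      · exact ⟨hu, hv, huv, hf⟩
      · have := hEQ p hp
        tauto
    · intro p hp q hq hpq
      rcases Finset.mem_insert.1 hp with rfl | hp <;> rcases Finset.mem_insert.1 hq with rfl | hq
      · exact absurd rfl hpq
      · have := hEQ q hq
        exact ⟨Ne.symm this.1.2.1, Ne.symm this.2.1.2.1, Ne.symm this.1.1, Ne.symm this.2.1.1⟩
      · have := hEQ p hp
        exact ⟨this.1.2.1, this.1.1, this.2.1.2.1, this.2.1.1⟩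
      · exact hd p hp q hq hpq

theorem exists_common_extension {α β : Type*} [Nonempty β] (E : Finset (α × α)) (b c : α × α → β)
    (hne : ∀ p ∈ E, p.1 ≠ p.2)
    (hd : ∀ p ∈ E, ∀ q ∈ E, p ≠ q → p.1 ≠ q.1 ∧ p.1 ≠ q.2 ∧ p.2 ≠ q.1 ∧ p.2 ≠ q.2) :
    ∃ a : α → β, ∀ p ∈ E, a p.1 = b p ∧ a p.2 = c p := by
  classical
  have key : ∀ u, ∃ z : β, ∀ p ∈ E, (p.1 = u → z = b p) ∧ (p.2 = u → z = c p) := by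
    intro u
    by_cases h : ∃ p ∈ E, p.1 = u ∨ p.2 = u
    · obtain ⟨p, hp, hpu⟩ := h
      refine ⟨if p.1 = u then b p else c p, fun q hq => ?_⟩
      by_cases hpq : p = q
      · subst hpq
        have := hne p hp
        grind
      · have := hd p hp q hq hpq
        grind
    · push Not at h
      exact ⟨Classical.arbitrary β, fun p hp => ⟨fun h' => absurd h' (h p hp).1,
        fun h' => absurd h' (h p hp).2⟩⟩
  choose a ha using key
  exact ⟨a, fun p hp => ⟨(ha _ p hp).1 rfl, (ha _ p hp).2 rfl⟩⟩

theorem refutable_of_depth_le_two {α : Type*} {s d r : ℕ} (hs : 0 < s) (hd : 1 ≤ d) (hr : 1 ≤ r)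
    (hsd : s ≤ d ^ r) (T : α → DTree s) (hT : ∀ u, (T u).depth ≤ 2) (Q : Finset α)
    (hQ : 5 * d * s ≤ Q.card) : Refutable (fun u => (T u).eval) Q (8 * r) := by
  classical
  choose i A B hA hB hT' using fun u => (T u).exists_probe hs (k := 1) (hT u)
  choose j la hla using fun u => (A u).exists_forced_bit hs (hA u)
  choose k lb hlb using fun u => (B u).exists_forced_bit hs (hB u)
  have : Nonempty (Fin s) := ⟨⟨0, hs⟩⟩
  obtain ⟨E, hE, hEQ, hdis⟩ := exists_disjoint_pairs i (2 * d * s) Q (by nlinarith)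
  obtain ⟨F, hFE, hF, b, c, hbc⟩ := exists_unsatisfiable_edges E (fun p => j p.1)
    (fun p => k p.2) d r hr (by simpa using hsd) (by simp [hE])
  obtain ⟨a, ha⟩ := exists_common_extension E (fun p => la p.1 (!b p)) (fun p => lb p.2 (!c p))
    (fun p hp => (hEQ p hp).2.2.1) hdis
  refine ⟨F.image Prod.fst ∪ F.image Prod.snd, ?_, ?_, a, fun σ => ?_⟩
  · intro u hu
    simp only [Finset.mem_union, Finset.mem_image] at hu
    rcases hu with ⟨p, hp, rfl⟩ | ⟨p, hp, rfl⟩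
    · exact (hEQ p (hFE hp)).1
    · exact (hEQ p (hFE hp)).2.1
  · refine (Finset.card_union_le _ _).trans ?_
    have h1 := Finset.card_image_le (s := F) (f := Prod.fst)
    have h2 := Finset.card_image_le (s := F) (f := Prod.snd)
    omega
  · obtain ⟨p, hp, hp1, hp2⟩ := hbc σ
    obtain ⟨ha1, ha2⟩ := ha p (hFE hp)
    have hi := (hEQ p (hFE hp)).2.2.2
    cases hσ : σ (i p.1)
    · refine ⟨p.1, Finset.mem_union_left _ (Finset.mem_image_of_mem _ hp), fun h => ?_⟩
      simp only [hT', hσ, ha1] at h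
      have := hla _ _ _ (by simpa using h)
      simp [hp1] at this
    · refine ⟨p.2, Finset.mem_union_right _ (Finset.mem_image_of_mem _ hp), fun h => ?_⟩
      simp only [hT', ← hi, hσ, ha2] at h
      have := hlb _ _ _ (by simpa using h)
      simp [hp2] at this

theorem refutable_of_depth_le {α : Type*} {s d r n K : ℕ} (hs : 0 < s) (hd : 1 ≤ d) (hr : 1 ≤ r)
    (hsd : s ≤ d ^ r) (hK : 5 * d * s ≤ K) (hnK : n ≤ K) (k : ℕ) (hk : 2 ^ k * (8 * r) ≤ n)
    (T : α → DTree s) (hT : ∀ u, (T u).depth ≤ k + 2) (Q : Finset α)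
    (hQ : (2 * s) ^ k * K ≤ Q.card) :
    Refutable (fun u => (T u).eval) Q (2 ^ k * (8 * r)) := by
  classical
  induction k generalizing T Q with
  | zero =>
    simpa using refutable_of_depth_le_two hs hd hr hsd T hT Q (hK.trans (by simpa using hQ))
  | succ k ih =>
    choose i A B hA hB hT' using fun u => (T u).exists_probe hs (k := k + 2) (hT u)
    set L := (2 * s) ^ k * K with hL
    have hnL : n ≤ L := hnK.trans (Nat.le_mul_of_pos_left _ (by positivity))
    have hk' : 2 ^ k * (8 * r) ≤ n := by
      rw [pow_succ] at hk
      linarith [Nat.zero_le (2 ^ k * (8 * r))]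
    have : Nonempty (Fin s) := ⟨⟨0, hs⟩⟩
    obtain ⟨z, -, hz⟩ := Finset.exists_le_card_fiber_of_mul_le_card_of_maps_to
      (s := Q) (t := Finset.univ) (f := i) (n := 2 * L) (by simp) Finset.univ_nonempty (by
        rw [Finset.card_univ, Fintype.card_fin]
        calc s * (2 * L) = (2 * s) ^ (k + 1) * K := by rw [hL, pow_succ]; ring
          _ ≤ _ := hQ)
    set R := Q.filter fun u => i u = z
    obtain ⟨P₀, hP₀, hc₀, a₀, h₀⟩ := ih hk' A hA R (by omega)
    obtain ⟨P₁, hP₁, hc₁, a₁, h₁⟩ := ih hk' B hB (R \ P₀) (by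
      have := Finset.card_sdiff_add_card_eq_card hP₀
      omega)
    have hRz : ∀ u ∈ R, u ∈ Q ∧ i u = z := fun u hu => Finset.mem_filter.1 hu
    have hP₁' : ∀ u ∈ P₁, u ∈ R ∧ u ∉ P₀ := fun u hu => Finset.mem_sdiff.1 (hP₁ hu)
    refine ⟨P₀ ∪ P₁, ?_, ?_, fun u => if u ∈ P₀ then a₀ u else a₁ u, fun σ => ?_⟩
    · exact Finset.union_subset (fun u hu => (hRz u (hP₀ hu)).1)
        (fun u hu => (hRz u (hP₁' u hu).1).1)
    · refine (Finset.card_union_le _ _).trans ?_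
      rw [pow_succ]
      linarith
    · cases hσ : σ z
      · obtain ⟨u, hu, hne⟩ := h₀ σ
        refine ⟨u, Finset.mem_union_left _ hu, ?_⟩
        simpa [hT', (hRz u (hP₀ hu)).2, hσ, hu] using hne
      · obtain ⟨u, hu, hne⟩ := h₁ σ
        refine ⟨u, Finset.mem_union_right _ hu, ?_⟩
        simpa [hT', (hRz u (hP₁' u hu).1).2, hσ, (hP₁' u hu).2] using hne

/-- The numerical content of the hypotheses: a density `d` that suits radius `n / 2 ^ (k + 3)`. -/
theorem exists_density {k s m n : ℕ} (hs : 0 < s) (hm : 0 < m) (hn : 0 < n) (h1 : 4 ^ (k + 2) ≤ n)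
    (h2 : (n : ℝ) ≤ (m : ℝ) ^ ((1 : ℝ) / (k + 1)))
    (h3 : 15 * (s : ℝ) ≤ (m : ℝ) ^ ((1 : ℝ) / (k + 1) * (1 - (4 : ℝ) ^ (k + 2) / n))) :
    ∃ d : ℕ, 1 ≤ d ∧ s ≤ d ^ (n / 2 ^ (k + 3)) ∧ (2 * s) ^ k * max (5 * d * s) n ≤ m := by
  have hm1 : (1 : ℝ) ≤ m := by exact_mod_cast hm
  have hm0 : (0 : ℝ) < m := by linarith
  have hn0 : (0 : ℝ) < n := by exact_mod_cast hn
  have hs1 : (1 : ℝ) ≤ s := by exact_mod_cast hs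
  have hk0 : (0 : ℝ) ≤ k := k.cast_nonneg
  set q : ℝ := (4 : ℝ) ^ (k + 2) / n with hq
  have hq0 : 0 ≤ q := by positivity
  have hq1 : q ≤ 1 := by
    rw [hq, div_le_one hn0]
    exact_mod_cast h1
  have hinv1 : (1 : ℝ) / (k + 1) ≤ 1 := by
    rw [div_le_one (by positivity)]
    linarith
  have hinv0 : (0 : ℝ) ≤ 1 / (k + 1) := by positivity
  set D : ℝ := (m : ℝ) ^ q with hD
  have hD1 : 1 ≤ D := Real.one_le_rpow hm1 hq0
  have hceil : D ≤ (⌈D⌉₊ : ℝ) := Nat.le_ceil D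
  have hceil2 : (⌈D⌉₊ : ℝ) ≤ 2 * D := by
    have := Nat.ceil_lt_add_one (zero_le_one.trans hD1)
    linarith
  refine ⟨⌈D⌉₊, Nat.ceil_pos.2 (by linarith), ?_, ?_⟩
  · set r := n / 2 ^ (k + 3) with hr
    have hnr : (n : ℝ) ≤ 4 ^ (k + 2) * (r + 1) := by
      have h : n < 2 ^ (k + 3) * (r + 1) := Nat.lt_mul_div_succ n (by positivity)
      have h' : 2 ^ (k + 3) ≤ 4 ^ (k + 2) := by
        rw [show 4 = 2 ^ 2 from rfl, ← pow_mul]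
        exact Nat.pow_le_pow_right (by norm_num) (by omega)
      have : n ≤ 4 ^ (k + 2) * (r + 1) := h.le.trans (Nat.mul_le_mul_right _ h')
      exact_mod_cast this
    have hqr : 1 - q ≤ q * r := by
      have : 1 ≤ q * (r + 1) := by
        rw [hq, div_mul_eq_mul_div, le_div_iff₀ hn0]
        linarith
      linarith
    have : (s : ℝ) ≤ (⌈D⌉₊ : ℝ) ^ r := calc
      (s : ℝ) ≤ (m : ℝ) ^ ((1 : ℝ) / (k + 1) * (1 - q)) := by linarith
      _ ≤ (m : ℝ) ^ (q * r) := by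
        refine Real.rpow_le_rpow_of_exponent_le hm1 (le_trans ?_ hqr)
        nlinarith
      _ = D ^ r := by rw [Real.rpow_mul hm0.le, Real.rpow_natCast]
      _ ≤ (⌈D⌉₊ : ℝ) ^ r := by gcongr
    exact_mod_cast this
  · rw [mul_max_of_nonneg _ _ (Nat.zero_le _)]
    refine max_le ?_ ?_
    · have hpow : (15 * (s : ℝ)) ^ (k + 1) ≤ (m : ℝ) ^ (1 - q) := by
        refine (pow_le_pow_left₀ (by positivity) h3 _).trans_eq ?_
        rw [← Real.rpow_natCast, ← Real.rpow_mul hm0.le]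
        congr 1
        push_cast
        field_simp
      have : (2 * (s : ℝ)) ^ k * (5 * ⌈D⌉₊ * s) ≤ m := calc
        (2 * (s : ℝ)) ^ k * (5 * ⌈D⌉₊ * s) ≤ (15 * (s : ℝ)) ^ k * (5 * (2 * D) * s) := by
          gcongr
          norm_num
        _ ≤ (15 * (s : ℝ)) ^ k * (15 * s) * D := by
          rw [mul_assoc ((15 * (s : ℝ)) ^ k)]
          refine mul_le_mul_of_nonneg_left ?_ (by positivity)
          nlinarith
        _ = (15 * (s : ℝ)) ^ (k + 1) * D := by rw [pow_succ]
        _ ≤ (m : ℝ) ^ (1 - q) * D := by gcongr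
        _ = m := by rw [hD, ← Real.rpow_add hm0]; simp
      exact_mod_cast this
    · have h2s : 2 * (s : ℝ) ≤ (m : ℝ) ^ ((1 : ℝ) / (k + 1)) := calc
        2 * (s : ℝ) ≤ (m : ℝ) ^ ((1 : ℝ) / (k + 1) * (1 - q)) := by linarith
        _ ≤ _ := Real.rpow_le_rpow_of_exponent_le hm1 (by nlinarith)
      have : (2 * (s : ℝ)) ^ k * n ≤ m := calc
        (2 * (s : ℝ)) ^ k * n ≤ ((m : ℝ) ^ ((1 : ℝ) / (k + 1))) ^ k *
            (m : ℝ) ^ ((1 : ℝ) / (k + 1)) := by gcongr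
        _ = m := by
          rw [← pow_succ, ← Real.rpow_natCast, ← Real.rpow_mul hm0.le]
          push_cast
          rw [one_div, inv_mul_cancel₀ (by positivity), Real.rpow_one]
      exact_mod_cast this

/-- Suppose `t ≥ 2` and `s, m, n` are positive integers such that
`4^t ≤ n ≤ m^(1/(2(t-1)))` and `s ≤ (1/15)·m^((1/(t-1))·(1 - 4^t/n))`. Then for
every `(m,s,t)`-query scheme there are disjoint sets `S, T ⊆ [m]`, each of size
at most `n`, such that for every memory assignment `σ`, either some query in `S`
is answered No or some query in `T` is answered Yes. -/
theorem general_lower_bound_lemma (t s m n : ℕ)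
    (ht : 2 ≤ t) (hs : 0 < s) (hm : 0 < m) (hn : 0 < n)
    (h1 : 4 ^ t ≤ n) (h2 : (n : ℝ) ≤ (m : ℝ) ^ ((1 : ℝ) / (2 * ((t : ℝ) - 1))))
    (h3 : (s : ℝ) ≤ (1 / 15 : ℝ) * (m : ℝ) ^ (((1 : ℝ) / ((t : ℝ) - 1)) * (1 - (4 : ℝ) ^ t / (n : ℝ))))
    (T : Fin m → DTree s) (hT : ∀ u : Fin m, (T u).depth ≤ t) :
    ∃ S T' : Finset (Fin m), Disjoint S T' ∧ S.card ≤ n ∧ T'.card ≤ n ∧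
      ∀ σ : Fin s → Bool,
        (∃ u ∈ S, (T u).eval σ = false) ∨ (∃ u ∈ T', (T u).eval σ = true) := by
  obtain ⟨k, rfl⟩ : ∃ k, t = k + 2 := ⟨t - 2, by omega⟩
  have hk : (((k + 2 : ℕ) : ℝ) - 1) = k + 1 := by push_cast; ring
  rw [hk] at h2 h3
  have hm1 : (1 : ℝ) ≤ m := by exact_mod_cast hm
  have hk0 : (0 : ℝ) ≤ k := k.cast_nonneg
  obtain ⟨d, hd, hsd, hdm⟩ := exists_density hs hm hn h1
    (h2.trans (Real.rpow_le_rpow_of_exponent_le hm1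
      (one_div_le_one_div_of_le (by positivity) (by linarith)))) (by linarith)
  have hr : 1 ≤ n / 2 ^ (k + 3) := by
    rw [Nat.one_le_div_iff (by positivity)]
    refine le_trans ?_ h1
    rw [show 4 = 2 ^ 2 from rfl, ← pow_mul]
    exact Nat.pow_le_pow_right (by norm_num) (by omega)
  have hrn : 2 ^ k * (8 * (n / 2 ^ (k + 3))) ≤ n := by
    refine le_trans (le_of_eq ?_) (Nat.mul_div_le n (2 ^ (k + 3)))
    rw [pow_add 2 k 3]
    ring
  obtain ⟨P, -, hP, a, ha⟩ := refutable_of_depth_le hs hd hr hsd (le_max_left _ n)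
    (le_max_right _ _) k hrn T hT Finset.univ (by simpa using hdm)
  refine ⟨P.filter fun u => a u = true, P.filter fun u => a u = false, ?_,
    (Finset.card_filter_le _ _).trans (hP.trans hrn),
    (Finset.card_filter_le _ _).trans (hP.trans hrn), fun σ => ?_⟩
  · rw [Finset.disjoint_filter]
    intro u _ h
    simp [h]
  · obtain ⟨u, hu, hne⟩ := ha σ
    cases h : a u
    · exact .inr ⟨u, by simp [hu, h], by simpa [h] using hne⟩
    · exact .inl ⟨u, by simp [hu, h], by simpa [h] using hne⟩
end
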